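/- arXiv:2303.11719 — 2 statements merged into one kernel-verified Lean document; each statement's English description precedes it below -/
import Mathlib

section
/- If every edge of a graph G lies in a cut of size at most 2k-1 between its endpoints (in particular if G is minimally 2k-edge-connected), then G is (2k-1)-degenerate. -/
open Classical in
/-- An edge crosses `A`. -/
def XCross {V : Type*} (A : Set V) (e : Sym2 V) : Prop := (∃ x ∈ e, x ∈ A) ∧ ∃ x ∈ e, x ∉ A

lemma xcross_mk {V : Type*} (A : Set V) (a b : V) :
    XCross A s(a, b) ↔ ¬ (a ∈ A ↔ b ∈ A) := by
  simp only [XCross, Sym2.mem_iff, exists_eq_or_imp, exists_eq_left]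
  tauto

open Classical in
/-- Number of edges of `E` crossing `A`. -/
noncomputable def xd {V : Type*} [Fintype V] (E : Set (Sym2 V)) (A : Set V) : ℕ :=
  (Finset.univ.filter (fun e => e ∈ E ∧ XCross A e)).card

lemma xd_inter_union {V : Type*} [Fintype V] (E : Set (Sym2 V)) (X Y : Set V) :
    xd E (X ∩ Y) + xd E (X ∪ Y) ≤ xd E X + xd E Y := by
  classical
  simp only [xd, Finset.card_filter, ← Finset.sum_add_distrib]
  refine Finset.sum_le_sum fun e _ => ?_
  induction e with | _ a b =>
  simp only [xcross_mk, Set.mem_inter_iff, Set.mem_union]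
  by_cases s(a, b) ∈ E <;> by_cases a ∈ X <;> by_cases b ∈ X <;> by_cases a ∈ Y <;>
    by_cases b ∈ Y <;> simp [*]

lemma xd_diff {V : Type*} [Fintype V] (E : Set (Sym2 V)) (X Y : Set V) :
    xd E (X \ Y) + xd E (Y \ X) ≤ xd E X + xd E Y := by
  classical
  simp only [xd, Finset.card_filter, ← Finset.sum_add_distrib]
  refine Finset.sum_le_sum fun e _ => ?_
  induction e with | _ a b =>
  simp only [xcross_mk, Set.mem_diff]
  by_cases s(a, b) ∈ E <;> by_cases a ∈ X <;> by_cases b ∈ X <;> by_cases a ∈ Y <;>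
    by_cases b ∈ Y <;> simp [*]

/-- `A` is a minimum cut, of size at most `c`, for some pair `s ∈ A`, `t ∉ A`. -/
def XGood {V : Type*} [Fintype V] (E : Set (Sym2 V)) (c : ℕ) (A : Set V) : Prop :=
  xd E A ≤ c ∧ ∃ s t, s ∈ A ∧ t ∉ A ∧ s ∈ {x | ∃ e ∈ E, x ∈ e} ∧
    t ∈ {x | ∃ e ∈ E, x ∈ e} ∧ ∀ B : Set V, ¬ (s ∈ B ↔ t ∈ B) → xd E A ≤ xd E B

lemma xmin {V : Type*} [Fintype V] (E : Set (Sym2 V)) (A : Set V) (u v : V)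
    (hA : ¬ (u ∈ A ↔ v ∈ A)) : ∃ B : Set V, ¬ (u ∈ B ↔ v ∈ B) ∧ xd E B ≤ xd E A ∧
      ∀ C : Set V, ¬ (u ∈ C ↔ v ∈ C) → xd E B ≤ xd E C := by
  obtain ⟨B, hB, hm⟩ := Set.exists_min_image {B : Set V | ¬ (u ∈ B ↔ v ∈ B)} (xd E)
    (Set.toFinite _) ⟨A, hA⟩
  exact ⟨B, hB, hm A hA, hm⟩

lemma xgood_of {V : Type*} [Fintype V] (E : Set (Sym2 V)) (c : ℕ) (B : Set V) (u v : V)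
    (hu : ∃ e ∈ E, u ∈ e) (hv : ∃ e ∈ E, v ∈ e)
    (hB : ¬ (u ∈ B ↔ v ∈ B)) (hc : xd E B ≤ c)
    (hm : ∀ C : Set V, ¬ (u ∈ C ↔ v ∈ C) → xd E B ≤ xd E C) : XGood E c B := by
  by_cases h : u ∈ B
  · exact ⟨hc, u, v, h, by tauto, hu, hv, hm⟩
  · exact ⟨hc, v, u, by tauto, h, hv, hu, fun C hC => hm C (by tauto)⟩

theorem stmt_4 {V : Type*} [Fintype V] (k : ℕ) (hk : 0 < k) (G : SimpleGraph V)
    (h : ∀ u v : V, G.Adj u v → ∃ F : Set (Sym2 V), F ⊆ G.edgeSet ∧ F.ncard ≤ 2 * k - 1 ∧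
      ¬ (G.deleteEdges F).Reachable u v) :
    ∀ S : Set V, S.Nonempty → ∃ v ∈ S, {w | w ∈ S ∧ G.Adj v w}.ncard ≤ 2 * k - 1 := by
  classical
  rintro S ⟨z, hz⟩
  by_contra! hdeg
  generalize 2 * k - 1 = c at *
  let E : Set (Sym2 V) := {e | e ∈ G.edgeSet ∧ ∀ x ∈ e, x ∈ S}
  have hE : ∀ a b, s(a, b) ∈ E ↔ G.Adj a b ∧ a ∈ S ∧ b ∈ S := by
    intro a b; simp [E]
  have hES : ∀ x, (∃ e ∈ E, x ∈ e) → x ∈ S := fun x ⟨e, he, hx⟩ => he.2 x hx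
  -- edges are separated by small sets
  have hsep : ∀ u v, s(u, v) ∈ E → ∃ A : Set V, ¬ (u ∈ A ↔ v ∈ A) ∧ xd E A ≤ c := by
    intro u v huv
    obtain ⟨F, -, hFc, hF⟩ := h u v ((hE u v).1 huv).1
    refine ⟨{x | (G.deleteEdges F).Reachable u x}, ?_, ?_⟩
    · simp [hF]
    · refine le_trans ?_ hFc
      rw [xd, ← Set.ncard_coe_finset]
      refine Set.ncard_le_ncard ?_ (Set.toFinite _)
      intro e he
      induction e with | _ a b =>
      simp only [Finset.coe_filter, Finset.mem_univ, true_and, Set.mem_setOf_eq, xcross_mk] at he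
      by_contra hn
      have hab : (G.deleteEdges F).Adj a b := by
        rw [SimpleGraph.deleteEdges_adj]; exact ⟨((hE a b).1 he.1).1, hn⟩
      exact he.2 ⟨fun q => q.trans hab.reachable, fun q => q.trans hab.symm.reachable⟩
  have hnb : ∀ x ∈ S, ∃ y, s(x, y) ∈ E := by
    intro x hx
    have := hdeg x hx
    obtain ⟨y, hy⟩ := Set.nonempty_of_ncard_ne_zero (by omega : {w | w ∈ S ∧ G.Adj x w}.ncard ≠ 0)
    exact ⟨y, (hE x y).2 ⟨hy.2, hx, hy.1⟩⟩
  have hgood : ∀ u v, s(u, v) ∈ E → ∀ A : Set V, ¬ (u ∈ A ↔ v ∈ A) → xd E A ≤ c →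
      ∃ B, XGood E c B := by
    intro u v huv A hA hc
    obtain ⟨B, h1, h2, h3⟩ := xmin E A u v hA
    exact ⟨B, xgood_of E c B u v ⟨_, huv, by simp⟩ ⟨_, huv, by simp⟩ h1 (h2.trans hc) h3⟩
  obtain ⟨y, hy⟩ := hnb z hz
  obtain ⟨A, hA, hAc⟩ := hsep z y hy
  have hne := hgood z y hy A hA hAc
  obtain ⟨X, hX, hXmin⟩ := Set.exists_min_image {B : Set V | XGood E c B} Set.ncard
    (Set.toFinite _) hne
  obtain ⟨hXc, s, t, hs, ht, hsE, htE, hst⟩ := hX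
  have hlt : ∀ B : Set V, XGood E c B → B ⊆ X → X ⊆ B := by
    intro B hB hBX
    exact (Set.eq_of_subset_of_ncard_le hBX (hXmin B hB) (Set.toFinite _)).ge
  -- no edge inside X
  have hno : ∀ u v, s(u, v) ∈ E → u ∈ X → v ∈ X → False := by
    intro u v huv hu hv
    obtain ⟨A, hA, hAc⟩ := hsep u v huv
    obtain ⟨Y, h1, h2, h3⟩ := xmin E A u v hA
    have key : ∀ B : Set V, B ⊆ X → ¬ (u ∈ B ↔ v ∈ B) → xd E B ≤ xd E Y → False := by
      intro B hBX hB hd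
      have := hlt B (xgood_of E c B u v ⟨_, huv, by simp⟩ ⟨_, huv, by simp⟩ hB (by omega)
        (fun C hC => hd.trans (h3 C hC))) hBX
      exact hB ⟨fun _ => this hv, fun _ => this hu⟩
    have i1 := xd_inter_union E X Y
    have i2 := xd_diff E X Y
    by_cases hsY : s ∈ Y <;> by_cases htY : t ∈ Y
    · have := hst (Y \ X) (by simp [*])
      exact key (X \ Y) Set.diff_subset (by simp [hu, hv]; tauto) (by omega)
    · have := hst (X ∪ Y) (by simp [*])
      exact key (X ∩ Y) Set.inter_subset_left (by simp [hu, hv]; tauto) (by omega)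
    · have := hst (Y \ X) (by simp [*])
      exact key (X \ Y) Set.diff_subset (by simp [hu, hv]; tauto) (by omega)
    · have := hst (X ∪ Y) (by simp [*])
      exact key (X ∩ Y) Set.inter_subset_left (by simp [hu, hv]; tauto) (by omega)
  have hsS := hES s hsE
  have hd := hdeg s hsS
  have : {w | w ∈ S ∧ G.Adj s w}.ncard ≤ xd E X := by
    rw [xd, ← Set.ncard_coe_finset]
    refine Set.ncard_le_ncard_of_injOn (fun w => s(s, w)) ?_ ?_ (Set.toFinite _)
    · rintro w ⟨hw, hadj⟩
      have hw' := (hE s w).2 ⟨hadj, hsS, hw⟩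
      simp only [Finset.coe_filter, Finset.mem_univ, true_and, Set.mem_setOf_eq, xcross_mk]
      exact ⟨hw', fun q => hno s w hw' hs (q.1 hs)⟩
    · intro a _ b _ hab
      exact Sym2.congr_right.1 hab
  omega
end

section
/- For every positive integer k and every positive integer n ≥ k+1, every 2k-edge-connected digraph D on n vertices can be transformed into a k-arc-strong digraph by at most log₂ n + 4k - 3 inversions. -/
/-- Inversion of the vertex set `X` in the digraph `D`. -/
def dinv {V : Type*} (D : V → V → Prop) (X : Set V) : V → V → Prop :=
  fun u v => (u ∈ X ∧ v ∈ X ∧ D v u) ∨ (¬ (u ∈ X ∧ v ∈ X) ∧ D u v)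

/-- Successive inversions of a list of vertex sets. -/
def dinvFam {V : Type*} (D : V → V → Prop) (Xs : List (Set V)) : V → V → Prop :=
  Xs.foldl dinv D

/-- Number of arcs of `D` leaving the set `S`. -/
noncomputable def outCut {V : Type*} (D : V → V → Prop) (S : Set V) : ℕ :=
  {p : V × V | p.1 ∈ S ∧ p.2 ∉ S ∧ D p.1 p.2}.ncard

/-- `D` is `k`-arc-strong. -/
def kArcStrong {V : Type*} (D : V → V → Prop) (k : ℕ) : Prop :=
  ∀ S : Set V, S.Nonempty → S ≠ Set.univ → k ≤ outCut D S

/-- The underlying multigraph of `D` is `m`-edge-connected. -/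
def edgeConn {V : Type*} (D : V → V → Prop) (m : ℕ) : Prop :=
  ∀ S : Set V, S.Nonempty → S ≠ Set.univ →
    m ≤ outCut D S + outCut (fun a b => D b a) S



section PartO
open Finset
variable {V : Type*} [Fintype V] [DecidableEq V]

open Classical in
/-- atom lemma -/
theorem atom_int (T : Finset V → Prop) (μ : V → ℝ)
    (hcross : ∀ X Y, T X → T Y → (X ∩ Y).Nonempty → X ∪ Y ≠ univ → T (X ∩ Y) ∧ T (X ∪ Y))
    (hV : ∃ z : ℤ, ∑ v, μ v = z)
    (hT : ∀ X, T X → ∃ z : ℤ, ∑ v ∈ X, μ v = z) (a : V) :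
    ∃ z : ℤ, ∑ v ∈ univ.filter (fun v => ∀ X, T X → (v ∈ X ↔ a ∈ X)), μ v = z := by
  classical
  let M : Finset V → Prop := fun X => T X ∨ T Xᶜ ∨ X = univ
  let at' : V → Finset V := fun a => univ.filter (fun v => ∀ X, T X → (v ∈ X ↔ a ∈ X))
  have hMint : ∀ X, M X → ∃ z : ℤ, ∑ v ∈ X, μ v = z := by
    rintro X (h | h | h)
    · exact hT X h
    · obtain ⟨z, hz⟩ := hT _ h
      obtain ⟨w, hw⟩ := hV
      refine ⟨w - z, ?_⟩
      have := Finset.sum_add_sum_compl X μ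
      push_cast
      linarith
    · subst h; exact hV
  have hsat : ∀ X, M X → ∀ a ∈ X, at' a ⊆ X := by
    intro X hX a ha v hv
    simp only [at', mem_filter, mem_univ, true_and] at hv
    rcases hX with h | h | h
    · exact (hv X h).2 ha
    · by_contra hc
      have := (hv _ h).1 (by simpa using hc)
      simp at this; exact this ha
    · simp [h]
  have key : ∀ m : ℕ, ∀ X, X.card = m → M X → ∀ a ∈ X, ∃ z : ℤ, ∑ v ∈ at' a, μ v = z := by
    intro m
    induction m using Nat.strong_induction_on with
    | _ m ih =>
    intro X hXm hX a ha
    by_cases hsub : ∃ X', M X' ∧ X' ⊂ X ∧ a ∈ X'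
    · obtain ⟨X', h1, h2, h3⟩ := hsub
      exact ih X'.card (hXm ▸ card_lt_card h2) X' rfl h1 a h3
    have hoth : ∀ b ∈ X, b ∉ at' a → ∃ X', M X' ∧ X' ⊂ X ∧ b ∈ X' := by
      intro b hb hba
      have : ∃ Z, T Z ∧ ¬ (b ∈ Z ↔ a ∈ Z) := by
        by_contra hcon
        push Not at hcon
        exact hba (by simp only [at', mem_filter, mem_univ, true_and]; exact hcon)
      obtain ⟨Z, hZ, hsep⟩ := this
      have gen : ∀ c d, c ∈ X → d ∈ X → c ∈ Z → d ∉ Z → 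
          (∃ X', M X' ∧ X' ⊂ X ∧ c ∈ X') ∨ (∃ X', M X' ∧ X' ⊂ X ∧ d ∈ X') := by
        intro c d hc hd hcZ hdZ
        have small : Zᶜ ⊆ X → (∃ X', M X' ∧ X' ⊂ X ∧ d ∈ X') := by
          intro hs
          exact ⟨Zᶜ, Or.inr (Or.inl (by simpa using hZ)), 
            (Finset.ssubset_iff_of_subset hs).2 ⟨c, hc, by simpa using hcZ⟩, by simpa using hdZ⟩
        rcases hX with h | h | h
        · by_cases hu : Z ∪ X = univ
          · right; apply small
            intro v hv
            have : v ∈ Z ∪ X := by rw [hu]; simp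
            simp at hv this; tauto
          · left
            have := (hcross Z X hZ h ⟨c, by simp [hcZ, hc]⟩ hu).1
            exact ⟨Z ∩ X, Or.inl this, (Finset.ssubset_iff_of_subset inter_subset_right).2
              ⟨d, hd, by simp [hdZ]⟩, by simp [hcZ, hc]⟩
        · by_cases hi : (Z ∩ Xᶜ).Nonempty
          · by_cases hu : Z ∪ Xᶜ = univ
            · right; apply small
              intro v hv
              by_contra hvX
              obtain ⟨w, hw⟩ := hi
              have : d ∈ Z ∪ Xᶜ := by rw [hu]; simp
              simp [hdZ, hd] at this
            · right
              have := (hcross Z Xᶜ hZ h hi hu).2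
              refine ⟨X \ Z, Or.inr (Or.inl ?_), (Finset.ssubset_iff_of_subset sdiff_subset).2
                ⟨c, hc, by simp [hcZ]⟩, by simp [hdZ, hd]⟩
              convert this using 1
              ext v; simp; tauto
          · left
            refine ⟨Z, Or.inl hZ, (Finset.ssubset_iff_of_subset ?_).2 ⟨d, hd, hdZ⟩, hcZ⟩
            intro v hv
            by_contra hvX
            exact hi ⟨v, by simp [hv, hvX]⟩
        · left
          refine ⟨Z, Or.inl hZ, (Finset.ssubset_iff_of_subset (by simp [h])).2 ⟨d, hd, hdZ⟩, hcZ⟩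
      by_cases hbZ : b ∈ Z
      · have haZ : a ∉ Z := fun h => hsep (by simp [h, hbZ])
        rcases gen b a hb ha hbZ haZ with h | h
        · exact h
        · exact absurd h hsub
      · have haZ : a ∈ Z := by by_contra h; exact hsep (by simp [h, hbZ])
        rcases gen a b ha hb haZ hbZ with h | h
        · exact absurd h hsub
        · exact h
    have hrest : ∃ z : ℤ, ∑ v ∈ X \ at' a, μ v = z := by
      let R := X \ at' a
      have hint : ∀ b ∈ R, ∃ z : ℤ, ∑ v ∈ at' b, μ v = z := by
        intro b hb
        obtain ⟨X', h1, h2, h3⟩ := hoth b (mem_sdiff.1 hb).1 (mem_sdiff.1 hb).2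
        exact ih X'.card (hXm ▸ card_lt_card h2) X' rfl h1 b h3
      have hfib : ∑ v ∈ R, μ v = ∑ A ∈ R.image at', ∑ v ∈ R with at' v = A, μ v := by
        rw [Finset.sum_fiberwise_of_maps_to]
        intro v hv; exact mem_image_of_mem _ hv
      have hcl : ∀ A ∈ R.image at', ∃ z : ℤ, ∑ v ∈ R with at' v = A, μ v = z := by
        intro A hA
        obtain ⟨b, hb, rfl⟩ := mem_image.1 hA
        obtain ⟨z, hz⟩ := hint b hb
        refine ⟨z, ?_⟩
        rw [← hz]
        apply Finset.sum_congr _ (fun _ _ => rfl)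
        ext v
        simp only [mem_filter]
        have hself : ∀ v, v ∈ at' v := by intro v; simp [at']
        have heq : ∀ v w, v ∈ at' w → at' v = at' w := by
          intro v w h
          simp only [at', mem_filter, mem_univ, true_and] at h ⊢
          ext u
          simp only [mem_filter, mem_univ, true_and]
          exact ⟨fun h' X hX => (h' X hX).trans (h X hX), fun h' X hX => (h' X hX).trans (h X hX).symm⟩
        constructor
        · rintro ⟨_, h⟩; rw [← h]; exact hself v
        · intro h
          refine ⟨?_, heq _ _ h⟩
          have hb' := mem_sdiff.1 hb
          refine mem_sdiff.2 ⟨hsat X hX b hb'.1 h, fun h' => hb'.2 ?_⟩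
          rw [← heq _ _ h', heq _ _ h]; exact hself b
      choose! f hf using hcl
      refine ⟨∑ A ∈ R.image at', f A, ?_⟩
      change ∑ v ∈ R, μ v = _
      rw [hfib, Finset.sum_congr rfl hf]; push_cast; rfl
    obtain ⟨z1, h1⟩ := hrest
    obtain ⟨z2, h2⟩ := hMint X hX
    refine ⟨z2 - z1, ?_⟩
    have := Finset.sum_sdiff (f := μ) (hsat X hX a ha)
    push_cast
    linarith
  exact key _ univ rfl (Or.inr (Or.inr rfl)) a (mem_univ _)

/-- nonzero circulation in a multigraph without degree one nodes -/
theorem exists_circ {Q ι : Type*} [Fintype Q] [DecidableEq Q] [Fintype ι] [DecidableEq ι]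
    [Nonempty ι] (s t : ι → Q)
    (hdeg : ∀ i, ∀ q, (q = s i ∨ q = t i) → ∃ j, j ≠ i ∧ (q = s j ∨ q = t j)) :
    ∃ z : ι → ℝ, z ≠ 0 ∧ ∀ g : Q → ℝ, ∑ i, (g (t i) - g (s i)) * z i = 0 := by
  classical
  obtain ⟨i0⟩ := ‹Nonempty ι›
  let Q' : Finset Q := univ.filter (fun q => ∃ i, q = s i ∨ q = t i)
  have hcard : Q'.card ≤ Fintype.card ι := by
    have h1 : Q'.card * 2 ≤ (univ : Finset ι).card * 2 := by
      apply Finset.card_mul_le_card_mul (fun q i => q = s i ∨ q = t i)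
      · intro q hq
        obtain ⟨i, hi⟩ := (mem_filter.1 hq).2
        obtain ⟨j, hj, hj'⟩ := hdeg i q hi
        have : ({i, j} : Finset ι) ⊆ bipartiteAbove (fun q i => q = s i ∨ q = t i) univ q := by
          intro a ha
          simp only [mem_insert, mem_singleton] at ha
          simp only [bipartiteAbove, mem_filter, mem_univ, true_and]
          rcases ha with rfl | rfl
          · exact hi
          · exact hj'
        have h2 := card_le_card this
        rwa [card_pair hj.symm] at h2
      · intro i _
        have : bipartiteBelow (fun q i => q = s i ∨ q = t i) Q' i ⊆ {s i, t i} := by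
          intro q hq
          simpa [bipartiteBelow] using (mem_filter.1 hq).2
        exact (card_le_card this).trans card_le_two
    simpa using Nat.le_of_mul_le_mul_right h1 (by norm_num)
  have hs0 : s i0 ∈ Q' := by simp only [Q', mem_filter, mem_univ, true_and]; exact ⟨i0, Or.inl rfl⟩
  let Q'' := Q'.erase (s i0)
  let Φ : (ι → ℝ) →ₗ[ℝ] (Q'' → ℝ) :=
    { toFun := fun z q => ∑ i, ((if t i = q.1 then (1:ℝ) else 0) - (if s i = q.1 then 1 else 0)) * z i
      map_add' := by
        intro x y; ext q; simp [mul_add, Finset.sum_add_distrib]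
      map_smul' := by
        intro c x; ext q; simp only [Pi.smul_apply, smul_eq_mul, RingHom.id_apply, Finset.mul_sum]
        exact Finset.sum_congr rfl (fun i _ => by ring) }
  have hlt : Module.finrank ℝ (Q'' → ℝ) < Module.finrank ℝ (ι → ℝ) := by
    simp only [Module.finrank_fintype_fun_eq_card, Fintype.card_coe]
    have : Q''.card < Q'.card := card_lt_card (erase_ssubset hs0)
    omega
  have hker := LinearMap.ker_ne_bot_of_finrank_lt (f := Φ) hlt
  obtain ⟨z, hz, hz0⟩ := (Submodule.ne_bot_iff _).1 hker
  refine ⟨z, hz0, ?_⟩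
  have hdiv : ∀ q ∈ Q'', ∑ i, ((if t i = q then (1:ℝ) else 0) - (if s i = q then 1 else 0)) * z i = 0 := by
    intro q hq
    have := congrFun (LinearMap.mem_ker.1 hz) ⟨q, hq⟩
    simpa [Φ] using this
  have hsum : ∀ g : Q → ℝ, ∑ i, (g (t i) - g (s i)) * z i =
      ∑ q, g q * ∑ i, ((if t i = q then (1:ℝ) else 0) - (if s i = q then 1 else 0)) * z i := by
    intro g
    simp_rw [Finset.mul_sum]
    rw [Finset.sum_comm]
    refine Finset.sum_congr rfl (fun i _ => ?_)
    have : ∀ q, g q * (((if t i = q then (1:ℝ) else 0) - (if s i = q then 1 else 0)) * z i)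
        = (if t i = q then g q * z i else 0) - (if s i = q then g q * z i else 0) := by
      intro q; split_ifs <;> ring
    simp_rw [this, Finset.sum_sub_distrib]
    simp; ring
  have hdiv2 : ∀ q, q ≠ s i0 → ∑ i, ((if t i = q then (1:ℝ) else 0) - (if s i = q then 1 else 0)) * z i = 0 := by
    intro q hq
    by_cases hq' : q ∈ Q'
    · exact hdiv q (mem_erase.2 ⟨hq, hq'⟩)
    · apply Finset.sum_eq_zero
      intro i _
      have h1 : t i ≠ q := fun h => hq' (by simp only [Q', mem_filter, mem_univ, true_and]; exact ⟨i, Or.inr h.symm⟩)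
      have h2 : s i ≠ q := fun h => hq' (by simp only [Q', mem_filter, mem_univ, true_and]; exact ⟨i, Or.inl h.symm⟩)
      simp [h1, h2]
  have hdiv3 : ∑ i, ((if t i = s i0 then (1:ℝ) else 0) - (if s i = s i0 then 1 else 0)) * z i = 0 := by
    have h1 := hsum (fun _ => 1)
    simp only [sub_self, zero_mul, Finset.sum_const_zero, one_mul] at h1
    rw [Finset.sum_eq_single (s i0) (fun q _ hq => hdiv2 q hq) (by simp)] at h1
    exact h1.symm
  intro g
  rw [hsum]
  apply Finset.sum_eq_zero
  intro q _
  by_cases hq : q = s i0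
  · subst hq; rw [hdiv3]; simp
  · rw [hdiv2 q hq]; simp

theorem ratio_step {ι : Type*} (s : Finset ι) (a b : ι → ℝ)
    (h0 : ∀ i ∈ s, 0 ≤ a i) (h : ∀ i ∈ s, b i < 0 → 0 < a i) (hex : ∃ i ∈ s, b i < 0) :
    ∃ l : ℝ, 0 < l ∧ (∀ i ∈ s, 0 ≤ a i + l * b i) ∧ ∃ i ∈ s, b i < 0 ∧ a i + l * b i = 0 := by
  classical
  obtain ⟨i0, hi0, hb0⟩ := hex
  obtain ⟨j, hj, hmin⟩ := Finset.exists_min_image (s.filter (fun i => b i < 0)) (fun i => a i / (- b i))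
    ⟨i0, by simp [hi0, hb0]⟩
  simp only [mem_filter] at hj hmin
  have hbj : 0 < - b j := by linarith [hj.2]
  refine ⟨a j / (- b j), div_pos (h j hj.1 hj.2) hbj, ?_, j, hj.1, hj.2, ?_⟩
  · intro i hi
    by_cases hb : b i < 0
    · have := hmin i ⟨hi, hb⟩
      have hbi : 0 < - b i := by linarith
      rw [le_div_iff₀ hbi] at this
      linarith
    · have : 0 ≤ a j / (- b j) := (div_pos (h j hj.1 hj.2) hbj).le
      have := mul_nonneg this (not_lt.1 hb)
      linarith [h0 i hi]
  · have : b j ≠ 0 := by linarith [hj.2]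
    field_simp
    ring
end PartO

section PartP
set_option linter.unusedSectionVars false
open Finset
variable {V : Type*} [Fintype V] [DecidableEq V]

/-- indicator -/
def ind (X : Finset V) (v : V) : ℝ := if v ∈ X then 1 else 0

/-- fractional in-degree -/
noncomputable def rho (E : Finset (V × V)) (x : V × V → ℝ) (X : Finset V) : ℝ :=
  ∑ p ∈ E, ((ind X p.2 - ind X p.1) * x p + ind X p.1 * (1 - ind X p.2))

theorem rho_submod (E : Finset (V × V)) (x : V × V → ℝ) (X Y : Finset V) :
    rho E x (X ∩ Y) + rho E x (X ∪ Y) ≤ rho E x X + rho E x Y := by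
  unfold rho
  rw [← Finset.sum_add_distrib, ← Finset.sum_add_distrib]
  apply Finset.sum_le_sum
  intro p _
  simp only [ind, mem_inter, mem_union]
  by_cases h1 : p.1 ∈ X <;> by_cases h2 : p.1 ∈ Y <;> by_cases h3 : p.2 ∈ X <;>
    by_cases h4 : p.2 ∈ Y <;> simp [h1, h2, h3, h4] <;> linarith

theorem rho_split (E : Finset (V × V)) (x : V × V → ℝ) (X : Finset V) :
    ∃ z : ℤ, rho E x X = ∑ p ∈ E, (ind X p.2 - ind X p.1) * x p + z := by
  refine ⟨∑ p ∈ E, if p.1 ∈ X ∧ p.2 ∉ X then 1 else 0, ?_⟩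
  unfold rho
  rw [Finset.sum_add_distrib]
  congr 1
  push_cast
  apply Finset.sum_congr rfl
  intro p _
  by_cases h1 : p.1 ∈ X <;> by_cases h2 : p.2 ∈ X <;> simp [ind, h1, h2]

theorem rho_add (E : Finset (V × V)) (x z : V × V → ℝ) (l : ℝ) (X : Finset V) :
    rho E (fun p => x p + l * z p) X = rho E x X + l * ∑ p ∈ E, (ind X p.2 - ind X p.1) * z p := by
  unfold rho
  rw [Finset.mul_sum, ← Finset.sum_add_distrib]
  apply Finset.sum_congr rfl
  intro p _
  ring

theorem mu_sum (E : Finset (V × V)) (x : V × V → ℝ) (X : Finset V) :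
    ∑ v ∈ X, ∑ p ∈ E, (ind {v} p.2 - ind {v} p.1) * x p = ∑ p ∈ E, (ind X p.2 - ind X p.1) * x p := by
  rw [Finset.sum_comm]
  apply Finset.sum_congr rfl
  intro p _
  rw [← Finset.sum_mul, Finset.sum_sub_distrib]
  simp [ind]

theorem exists_dir (E : Finset (V × V)) (x : V × V → ℝ) (k : ℕ)
    (hfeas : ∀ X : Finset V, X.Nonempty → X ≠ univ → (k : ℝ) ≤ rho E x X)
    (U : Finset (V × V)) (hU : ∀ p, p ∈ U ↔ p ∈ E ∧ 0 < x p ∧ x p < 1)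
    (hx : ∀ p ∈ E, 0 ≤ x p ∧ x p ≤ 1) (hne : U.Nonempty) :
    ∃ z : V × V → ℝ, (∀ p, p ∉ U → z p = 0) ∧ (∃ p ∈ U, z p ≠ 0) ∧
      ∀ X : Finset V, X.Nonempty → X ≠ univ → rho E x X = k →
        ∑ p ∈ E, (ind X p.2 - ind X p.1) * z p = 0 := by
  classical
  let T : Finset V → Prop := fun X => X.Nonempty ∧ X ≠ univ ∧ rho E x X = k
  have hcross : ∀ X Y, T X → T Y → (X ∩ Y).Nonempty → X ∪ Y ≠ univ → T (X ∩ Y) ∧ T (X ∪ Y) := by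
    rintro X Y ⟨hX1, hX2, hX3⟩ ⟨hY1, hY2, hY3⟩ hi hu
    have hi2 : X ∩ Y ≠ univ := by
      intro h; apply hX2; apply univ_subset_iff.1; rw [← h]; exact inter_subset_left
    have hu2 : (X ∪ Y).Nonempty := hX1.mono subset_union_left
    have h1 := hfeas _ hi hi2
    have h2 := hfeas _ hu2 hu
    have h3 := rho_submod E x X Y
    exact ⟨⟨hi, hi2, by linarith⟩, ⟨hu2, hu, by linarith⟩⟩
  by_cases hin : ∃ p ∈ U, ∀ X, T X → (p.1 ∈ X ↔ p.2 ∈ X)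
  · obtain ⟨p, hp, hpX⟩ := hin
    refine ⟨fun q => if q = p then 1 else 0, ?_, ⟨p, hp, by simp⟩, ?_⟩
    · intro q hq
      have : q ≠ p := fun h => hq (h ▸ hp)
      simp [this]
    · intro X h1 h2 h3
      apply Finset.sum_eq_zero
      intro q _
      by_cases hqp : q = p
      · subst hqp
        have := hpX X ⟨h1, h2, h3⟩
        simp [ind, this]
      · simp [hqp]
  push Not at hin
  let μ : V → ℝ := fun v => ∑ p ∈ E, (ind {v} p.2 - ind {v} p.1) * x p
  have hat := atom_int T μ hcross ⟨0, by
      have := mu_sum E x univ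
      simp only [μ]; rw [this]; simp [ind]⟩ (by
      rintro X ⟨h1, h2, h3⟩
      obtain ⟨z, hz⟩ := rho_split E x X
      refine ⟨k - z, ?_⟩
      have := mu_sum E x X
      simp only [μ]; rw [this]; push_cast; linarith)
  let A : V → Finset V := fun a => univ.filter (fun v => ∀ X, T X → (v ∈ X ↔ a ∈ X))
  have hself : ∀ v, v ∈ A v := by intro v; simp [A]
  have heq : ∀ v w, v ∈ A w → A v = A w := by
    intro v w h
    simp only [A, mem_filter, mem_univ, true_and] at h ⊢
    ext u
    simp only [mem_filter, mem_univ, true_and]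
    exact ⟨fun h' X hX => (h' X hX).trans (h X hX), fun h' X hX => (h' X hX).trans (h X hX).symm⟩
  have hmem : ∀ v w, v ∈ A w ↔ A v = A w := by
    intro v w
    exact ⟨heq v w, fun h => h ▸ hself v⟩
  have hdiff : ∀ p ∈ U, A p.1 ≠ A p.2 := by
    intro p hp h
    obtain ⟨X, hX, hX'⟩ := hin p hp
    have : p.1 ∈ A p.2 := (hmem _ _).2 h
    simp only [A, mem_filter, mem_univ, true_and] at this
    have := this X hX
    tauto
  have hatom : ∀ a, ∃ z : ℤ, ∑ p ∈ E, (ind (A a) p.2 - ind (A a) p.1) * x p = z := by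
    intro a
    obtain ⟨z, hz⟩ := hat a
    refine ⟨z, ?_⟩
    rw [← hz, ← mu_sum]
    refine Finset.sum_congr ?_ (fun _ _ => rfl)
    ext v; simp [A]
  have : Nonempty {p // p ∈ U} := by obtain ⟨p, hp⟩ := hne; exact ⟨⟨p, hp⟩⟩
  obtain ⟨z, hz0, hz⟩ := exists_circ (Q := Finset V) (ι := {p // p ∈ U}) (fun p => A p.1.1) (fun p => A p.1.2) (by
    rintro ⟨p, hp⟩ q hq
    by_contra hcon
    push Not at hcon
    have ha : ∃ a, q = A a := by
      rcases hq with h | h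
      · exact ⟨_, h⟩
      · exact ⟨_, h⟩
    obtain ⟨a, rfl⟩ := ha
    obtain ⟨m, hm⟩ := hatom a
    have hpE := ((hU p).1 hp)
    rw [← Finset.add_sum_erase E _ hpE.1] at hm
    have hrest : ∃ w : ℤ, ∑ r ∈ E.erase p, (ind (A a) r.2 - ind (A a) r.1) * x r = w := by
      have : ∀ r ∈ E.erase p, ∃ w : ℤ, (ind (A a) r.2 - ind (A a) r.1) * x r = w := by
        intro r hr
        have hr' := mem_erase.1 hr
        by_cases hrU : r ∈ U
        · have := hcon ⟨r, hrU⟩ (by simpa using hr'.1)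
          refine ⟨0, ?_⟩
          have h1 : r.1 ∉ A a := fun h => this.1 ((hmem _ _).1 h).symm
          have h2 : r.2 ∉ A a := fun h => this.2 ((hmem _ _).1 h).symm
          simp [ind, h1, h2]
        · have hxr : x r = 0 ∨ x r = 1 := by
            have h1 := hx r hr'.2
            have h2 : ¬ (0 < x r ∧ x r < 1) := fun h => hrU ((hU r).2 ⟨hr'.2, h⟩)
            by_cases h3 : 0 < x r
            · right; have : ¬ x r < 1 := fun h => h2 ⟨h3, h⟩
              linarith
            · left; linarith
          refine ⟨((if r.2 ∈ A a then 1 else 0) - (if r.1 ∈ A a then 1 else 0)) * (if x r = 0 then 0 else 1), ?_⟩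
          rcases hxr with h | h <;> simp [ind, h]
      choose! f hf using this
      refine ⟨∑ r ∈ E.erase p, f r, ?_⟩
      rw [Finset.sum_congr rfl hf]; push_cast; rfl
    obtain ⟨w, hw⟩ := hrest
    rw [hw] at hm
    have hd := hdiff p hp
    have hpm : ∃ w : ℤ, x p = w := by
      rcases hq with h | h
      · have h1 : p.1 ∈ A a := (hmem _ _).2 h.symm
        have h2 : p.2 ∉ A a := fun h' => hd (by rw [(hmem _ _).1 h', h])
        simp [ind, h1, h2] at hm
        exact ⟨w - m, by push_cast; linarith⟩
      · have h1 : p.2 ∈ A a := (hmem _ _).2 h.symm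
        have h2 : p.1 ∉ A a := fun h' => hd (by rw [(hmem _ _).1 h', h])
        simp [ind, h1, h2] at hm
        exact ⟨m - w, by push_cast; linarith⟩
    obtain ⟨w', hw'⟩ := hpm
    have h1 := hpE.2.1
    have h2 := hpE.2.2
    rw [hw'] at h1 h2
    have h1' : (0:ℤ) < w' := by exact_mod_cast h1
    have h2' : w' < (1:ℤ) := by exact_mod_cast h2
    omega)
  refine ⟨fun p => if h : p ∈ U then z ⟨p, h⟩ else 0, ?_, ?_, ?_⟩
  · intro p hp; simp [hp]
  · by_contra hcon
    push Not at hcon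
    apply hz0
    ext ⟨p, hp⟩
    have := hcon p hp
    simpa [hp] using this
  · intro X h1 h2 h3
    have hX : T X := ⟨h1, h2, h3⟩
    have hsub : ∀ v, A v ⊆ X ↔ v ∈ X := by
      intro v
      constructor
      · intro h; exact h (hself v)
      · intro h u hu
        simp only [A, mem_filter, mem_univ, true_and] at hu
        exact (hu X hX).2 h
    have := hz (fun A => if A ⊆ X then 1 else 0)
    simp only [hsub] at this
    have hUE : U ⊆ E := fun p hp => ((hU p).1 hp).1
    rw [← Finset.sum_subset hUE (by intro p _ hp; simp [hp]), ← Finset.sum_coe_sort, ← this]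
    apply Finset.sum_congr rfl
    rintro ⟨p, hp⟩ _
    simp [hp, ind]

theorem rounding (E : Finset (V × V)) (k : ℕ) : ∀ m : ℕ, ∀ x : V × V → ℝ,
    ((E.filter (fun p => 0 < x p ∧ x p < 1)).card
      + (univ.filter (fun X : Finset V => rho E x X ≠ k)).card ≤ m) →
    (∀ p ∈ E, 0 ≤ x p ∧ x p ≤ 1) →
    (∀ X : Finset V, X.Nonempty → X ≠ univ → (k : ℝ) ≤ rho E x X) →
    ∃ y : V × V → ℝ, (∀ p ∈ E, y p = 0 ∨ y p = 1) ∧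
      (∀ p ∈ E, x p = 0 ∨ x p = 1 → y p = x p) ∧
      (∀ X : Finset V, X.Nonempty → X ≠ univ → (k : ℝ) ≤ rho E y X) := by
  classical
  intro m
  have hint : ∀ x : V × V → ℝ, (∀ p ∈ E, 0 ≤ x p ∧ x p ≤ 1) →
      ¬ (E.filter (fun p => 0 < x p ∧ x p < 1)).Nonempty → ∀ p ∈ E, x p = 0 ∨ x p = 1 := by
    intro x hx hne p hp
    have h2 : ¬ (0 < x p ∧ x p < 1) := fun h => hne ⟨p, by simp [hp, h]⟩
    have h1 := hx p hp
    by_cases h3 : 0 < x p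
    · right; have : ¬ x p < 1 := fun h => h2 ⟨h3, h⟩
      linarith
    · left; linarith
  induction m with
  | zero =>
    intro x hm hx hf
    refine ⟨x, hint x hx ?_, fun _ _ _ => rfl, hf⟩
    intro h
    have := card_pos.2 h
    omega
  | succ m ih =>
    intro x hm hx hf
    by_cases hne : (E.filter (fun p => 0 < x p ∧ x p < 1)).Nonempty
    swap
    · exact ⟨x, hint x hx hne, fun _ _ _ => rfl, hf⟩
    set U := E.filter (fun p => 0 < x p ∧ x p < 1) with hUdef
    have hU : ∀ p, p ∈ U ↔ p ∈ E ∧ 0 < x p ∧ x p < 1 := by intro p; simp [hUdef]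
    obtain ⟨z, hz0, ⟨p0, hp0, hzp0⟩, hz⟩ := exists_dir E x k hf U hU hx hne
    let P : Finset (Finset V) := univ.filter (fun X => X.Nonempty ∧ X ≠ univ)
    let a : ((V × V) ⊕ (V × V)) ⊕ Finset V → ℝ :=
      Sum.elim (Sum.elim (fun p => x p) (fun p => 1 - x p)) (fun X => rho E x X - k)
    let b : ((V × V) ⊕ (V × V)) ⊕ Finset V → ℝ :=
      Sum.elim (Sum.elim (fun p => z p) (fun p => - z p))
        (fun X => ∑ p ∈ E, (ind X p.2 - ind X p.1) * z p)
    have hs : ∀ i ∈ (U.disjSum U).disjSum P, 0 ≤ a i ∧ (b i < 0 → 0 < a i) := by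
      rintro ((p | p) | X) hi
      · simp only [inl_mem_disjSum] at hi
        have := (hU p).1 hi
        exact ⟨this.2.1.le, fun _ => this.2.1⟩
      · simp only [inl_mem_disjSum, inr_mem_disjSum] at hi
        have := (hU p).1 hi
        simp only [a, Sum.elim_inl, Sum.elim_inr]
        exact ⟨by linarith, fun _ => by linarith⟩
      · simp only [inr_mem_disjSum, P, mem_filter, mem_univ, true_and] at hi
        simp only [a, b, Sum.elim_inr]
        have h1 := hf X hi.1 hi.2
        refine ⟨by linarith, fun hb => ?_⟩
        rcases h1.lt_or_eq with h | h
        · linarith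
        · rw [hz X hi.1 hi.2 h.symm] at hb
          exact absurd hb (lt_irrefl _)
    obtain ⟨l, hl, hl1, i, hi, hbi, hai⟩ := ratio_step ((U.disjSum U).disjSum P) a b
      (fun i hi => (hs i hi).1) (fun i hi => (hs i hi).2) (by
        rcases lt_or_gt_of_ne hzp0 with h | h
        · exact ⟨Sum.inl (Sum.inl p0), by simpa using hp0, by simpa [b] using h⟩
        · exact ⟨Sum.inl (Sum.inr p0), by simpa using hp0, by simpa [b] using h⟩)
    let y : V × V → ℝ := fun p => x p + l * z p
    have hyU : ∀ p, p ∉ U → y p = x p := by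
      intro p hp; simp [y, hz0 p hp]
    have hy01 : ∀ p ∈ E, 0 ≤ y p ∧ y p ≤ 1 := by
      intro p hp
      by_cases hpU : p ∈ U
      · have h1 := hl1 (Sum.inl (Sum.inl p)) (by simpa using hpU)
        have h2 := hl1 (Sum.inl (Sum.inr p)) (by simpa using hpU)
        simp only [a, b, Sum.elim_inl, Sum.elim_inr] at h1 h2
        simp only [y]
        exact ⟨h1, by linarith⟩
      · rw [hyU p hpU]; exact hx p hp
    have hyf : ∀ X : Finset V, X.Nonempty → X ≠ univ → (k : ℝ) ≤ rho E y X := by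
      intro X h1 h2
      have := hl1 (Sum.inr X) (by simp [P, h1, h2])
      simp only [a, b, Sum.elim_inr] at this
      rw [rho_add]; linarith
    have hUy : E.filter (fun p => 0 < y p ∧ y p < 1) ⊆ U := by
      intro p hp
      by_contra hpU
      simp only [mem_filter] at hp
      rw [hyU p hpU] at hp
      exact hpU ((hU p).2 hp)
    have hTy : univ.filter (fun X : Finset V => rho E y X ≠ k) ⊆
        univ.filter (fun X : Finset V => rho E x X ≠ k) := by
      intro X hX
      simp only [mem_filter, mem_univ, true_and] at hX ⊢
      intro h
      apply hX
      rw [rho_add, h]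
      have h0 : ∑ p ∈ E, (ind X p.2 - ind X p.1) * z p = 0 := by
        by_cases h1 : X.Nonempty
        · by_cases h2 : X = univ
          · subst h2; simp [ind]
          · exact hz X h1 h2 h
        · rw [not_nonempty_iff_eq_empty] at h1
          subst h1; simp [ind]
      rw [h0]; ring
    have hlt : (E.filter (fun p => 0 < y p ∧ y p < 1)).card
        + (univ.filter (fun X : Finset V => rho E y X ≠ k)).card <
        U.card + (univ.filter (fun X : Finset V => rho E x X ≠ k)).card := by
      have hUlt : ∀ p ∈ U, ¬ (0 < y p ∧ y p < 1) →
          (E.filter (fun p => 0 < y p ∧ y p < 1)).card < U.card := by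
        intro p hp hpy
        apply card_lt_card
        refine (Finset.ssubset_iff_of_subset hUy).2 ⟨p, hp, ?_⟩
        simp only [mem_filter, not_and]
        intro _; simpa using hpy
      have hc1 := card_le_card hUy
      have hc2 := card_le_card hTy
      rcases i with (p | p) | X
      · have := hUlt p (by simpa using hi) (by
          simp only [a, b, Sum.elim_inl] at hai
          simp only [y]; rw [hai]; simp)
        omega
      · have := hUlt p (by simpa using hi) (by
          simp only [a, b, Sum.elim_inl, Sum.elim_inr] at hai
          rintro ⟨_, h⟩
          simp only [y] at h; linarith)
        omega
      · have : (univ.filter (fun X : Finset V => rho E y X ≠ k)).card <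
            (univ.filter (fun X : Finset V => rho E x X ≠ k)).card := by
          apply card_lt_card
          simp only [a, b, Sum.elim_inr] at hai hbi
          refine (Finset.ssubset_iff_of_subset hTy).2 ⟨X, ?_, ?_⟩
          · simp only [mem_filter, mem_univ, true_and]
            intro h
            rw [h] at hai
            have := mul_neg_of_pos_of_neg hl hbi
            linarith
          · simp only [mem_filter, mem_univ, true_and, not_not]
            rw [rho_add]; linarith
        omega
    obtain ⟨w, hw1, hw2, hw3⟩ := ih y (by omega) hy01 hyf
    refine ⟨w, hw1, ?_, hw3⟩
    intro p hp hxp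
    have hpU : p ∉ U := by
      rw [hU]; rintro ⟨_, h1, h2⟩
      rcases hxp with h | h <;> linarith
    rw [← hyU p hpU]
    apply hw2 p hp
    rw [hyU p hpU]; exact hxp

end PartP

section PartQ
open Finset
set_option linter.unusedSectionVars false
variable {V : Type*} [Fintype V] [DecidableEq V]

/-- undirected degree of a set -/
def dE (E : Finset (V × V)) (X : Finset V) : ℕ := (E.filter (fun p => ¬ (p.1 ∈ X ↔ p.2 ∈ X))).card

theorem half_rho (E : Finset (V × V)) (X : Finset V) :
    rho E (fun p => if p.swap ∈ E then 1 else 1 / 2) X = (dE E X : ℝ) / 2 := by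
  have h1 : (dE E X : ℝ) / 2 = ∑ p ∈ E, (if ¬ (p.1 ∈ X ↔ p.2 ∈ X) then (1 / 2 : ℝ) else 0) := by
    unfold dE
    rw [Finset.card_filter]
    push_cast
    rw [Finset.sum_div]
    apply Finset.sum_congr rfl
    intro p _
    split_ifs <;> simp
  rw [h1, ← sub_eq_zero]
  unfold rho
  rw [← Finset.sum_sub_distrib]
  apply Finset.sum_involution (fun p _ => if p.swap ∈ E then p.swap else p)
  · intro p hp
    by_cases hs : p.swap ∈ E
    · simp only [hs, if_true, Prod.swap_swap, hp, Prod.fst_swap, Prod.snd_swap, ind]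
      by_cases h2 : p.1 ∈ X <;> by_cases h3 : p.2 ∈ X <;> simp [h2, h3] <;> norm_num
    · simp only [hs, if_false, ind]
      by_cases h2 : p.1 ∈ X <;> by_cases h3 : p.2 ∈ X <;> simp [h2, h3] <;> norm_num
  · intro p hp hne heq
    apply hne
    by_cases hs : p.swap ∈ E
    · simp only [hs, if_true] at heq ⊢
      have : p.1 = p.2 := by
        have := congrArg Prod.snd heq
        simpa using this
      simp [this]
      by_cases h3 : p.2 ∈ X <;> simp [ind, h3]
    · simp only [hs, if_false, ind]
      by_cases h2 : p.1 ∈ X <;> by_cases h3 : p.2 ∈ X <;> simp [h2, h3] <;> norm_num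
  · intro p hp
    by_cases hs : p.swap ∈ E <;> simp [hs, hp]
  · intro p hp
    by_cases hs : p.swap ∈ E <;> simp [hs, hp]

theorem orient (E : Finset (V × V)) (k : ℕ)
    (hcut : ∀ X : Finset V, X.Nonempty → X ≠ univ → 2 * k ≤ dE E X) :
    ∃ R : Finset (V × V), R ⊆ E ∧ (∀ p ∈ R, p.swap ∉ E) ∧
      ∀ X : Finset V, X.Nonempty → X ≠ univ →
        k ≤ (E.filter (fun p => if p ∈ R then p.2 ∈ X ∧ p.1 ∉ X else p.1 ∈ X ∧ p.2 ∉ X)).card := by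
  obtain ⟨y, hy1, hy2, hy3⟩ := rounding E k _ (fun p => if p.swap ∈ E then 1 else 1 / 2) le_rfl
    (by intro p _; split_ifs <;> norm_num)
    (by
      intro X h1 h2
      rw [half_rho]
      have : ((2 * k : ℕ) : ℝ) ≤ dE E X := by exact_mod_cast hcut X h1 h2
      push_cast at this
      linarith)
  refine ⟨E.filter (fun p => y p = 0), filter_subset _ _, ?_, ?_⟩
  · intro p hp hs
    simp only [mem_filter] at hp
    have := hy2 p hp.1 (by simp [hs])
    simp [hs, hp.2] at this
  · intro X h1 h2
    have h3 := hy3 Xᶜ (by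
      rw [nonempty_iff_ne_empty]; intro h; exact h2 ((compl_eq_empty_iff X).1 h)) (by
      intro h; rw [compl_eq_univ_iff] at h; subst h; simp at h1)
    have h4 : rho E y Xᶜ = ((E.filter (fun p => if p ∈ E.filter (fun p => y p = 0) then p.2 ∈ X ∧ p.1 ∉ X
        else p.1 ∈ X ∧ p.2 ∉ X)).card : ℝ) := by
      rw [Finset.card_filter]
      push_cast
      unfold rho
      apply Finset.sum_congr rfl
      intro p hp
      rcases hy1 p hp with h | h <;> by_cases h2 : p.1 ∈ X <;> by_cases h3 : p.2 ∈ X <;>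
        simp [ind, hp, h, h2, h3]
    rw [h4] at h3
    exact_mod_cast h3

end PartQ

section PartL
open Finset
set_option linter.unusedSectionVars false
variable {V : Type*} [Fintype V] [DecidableEq V]

theorem dE_sum (E : Finset (V × V)) (X : Finset V) :
    dE E X = ∑ p ∈ E, if ¬ (p.1 ∈ X ↔ p.2 ∈ X) then 1 else 0 := by
  unfold dE; rw [Finset.card_filter]

theorem dE_compl (E : Finset (V × V)) (X : Finset V) : dE E Xᶜ = dE E X := by
  rw [dE_sum, dE_sum]
  apply Finset.sum_congr rfl
  intro p _
  by_cases h1 : p.1 ∈ X <;> by_cases h2 : p.2 ∈ X <;> simp [h1, h2]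

theorem dE_sub1 (E : Finset (V × V)) (X Y : Finset V) :
    dE E (X ∩ Y) + dE E (X ∪ Y) ≤ dE E X + dE E Y := by
  simp only [dE_sum]
  rw [← Finset.sum_add_distrib, ← Finset.sum_add_distrib]
  apply Finset.sum_le_sum
  intro p _
  by_cases h1 : p.1 ∈ X <;> by_cases h2 : p.1 ∈ Y <;> by_cases h3 : p.2 ∈ X <;>
    by_cases h4 : p.2 ∈ Y <;> simp [h1, h2, h3, h4]

theorem dE_sub2 (E : Finset (V × V)) (X Y : Finset V) :
    dE E (X \ Y) + dE E (Y \ X) ≤ dE E X + dE E Y := by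
  simp only [dE_sum]
  rw [← Finset.sum_add_distrib, ← Finset.sum_add_distrib]
  apply Finset.sum_le_sum
  intro p _
  by_cases h1 : p.1 ∈ X <;> by_cases h2 : p.1 ∈ Y <;> by_cases h3 : p.2 ∈ X <;>
    by_cases h4 : p.2 ∈ Y <;> simp [h1, h2, h3, h4]

theorem exists_min_E (E0 : Finset (V × V)) (m : ℕ)
    (hcut : ∀ X : Finset V, X.Nonempty → X ≠ univ → m ≤ dE E0 X) (r : V) :
    ∃ E ⊆ E0, (∀ X : Finset V, X.Nonempty → X ≠ univ → m ≤ dE E X) ∧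
      ∀ p ∈ E, ∃ X : Finset V, X.Nonempty ∧ r ∉ X ∧ dE E X = m ∧ ¬ (p.1 ∈ X ↔ p.2 ∈ X) := by
  classical
  obtain ⟨E, hE, hmin⟩ := Finset.exists_min_image
    (E0.powerset.filter (fun E => ∀ X : Finset V, X.Nonempty → X ≠ univ → m ≤ dE E X)) card
    ⟨E0, by simpa using hcut⟩
  simp only [mem_filter, mem_powerset] at hE hmin
  refine ⟨E, hE.1, hE.2, ?_⟩
  intro p hp
  by_contra hcon
  push Not at hcon
  have hno : ∀ X : Finset V, X.Nonempty → X ≠ univ → dE E X = m → (p.1 ∈ X ↔ p.2 ∈ X) := by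
    intro X h1 h2 h3
    by_cases hr : r ∈ X
    · have := hcon Xᶜ (by
        rw [nonempty_iff_ne_empty]; intro h; exact h2 ((compl_eq_empty_iff X).1 h)) (by simpa using hr)
        (by rw [dE_compl, h3])
      simp only [mem_compl] at this
      by_cases h1 : p.1 ∈ X <;> by_cases h2 : p.2 ∈ X <;> simp_all
    · have := hcon X h1 hr h3
      by_cases h1 : p.1 ∈ X <;> by_cases h2 : p.2 ∈ X <;> simp_all
  have := hmin (E.erase p) ⟨(erase_subset _ _).trans hE.1, by
    intro X h1 h2
    have h3 := hE.2 X h1 h2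
    have h4 : dE E X = (if ¬ (p.1 ∈ X ↔ p.2 ∈ X) then 1 else 0) + dE (E.erase p) X := by
      rw [dE_sum, dE_sum]
      exact (Finset.add_sum_erase E (fun q => if ¬ (q.1 ∈ X ↔ q.2 ∈ X) then 1 else 0) hp).symm
    have h5 := hno X h1 h2
    by_cases h6 : dE E X = m
    · have := h5 h6
      simp only [this, not_true, if_false] at h4
      omega
    · split_ifs at h4 <;> omega⟩
  have h2 := card_erase_lt_of_mem hp
  omega

theorem exists_laminar (E : Finset (V × V)) (m : ℕ) (r : V)
    (hcut : ∀ X : Finset V, X.Nonempty → X ≠ univ → m ≤ dE E X)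
    (htight : ∀ p ∈ E, ∃ X : Finset V, X.Nonempty ∧ r ∉ X ∧ dE E X = m ∧ ¬ (p.1 ∈ X ↔ p.2 ∈ X)) :
    ∃ L : Finset (Finset V), (∀ X ∈ L, X.Nonempty ∧ r ∉ X ∧ dE E X = m) ∧
      (∀ X ∈ L, ∀ Y ∈ L, X ⊆ Y ∨ Y ⊆ X ∨ Disjoint X Y) ∧
      (∀ p ∈ E, ∃ X ∈ L, ¬ (p.1 ∈ X ↔ p.2 ∈ X)) := by
  classical
  obtain ⟨L, hL, hmax⟩ := Finset.exists_max_image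
    ((univ : Finset (Finset (Finset V))).filter (fun L => (∀ X ∈ L, X.Nonempty ∧ r ∉ X ∧ dE E X = m) ∧
      (∀ X ∈ L, ∀ Y ∈ L, X ⊆ Y ∨ Y ⊆ X ∨ Disjoint X Y))) card ⟨∅, by simp⟩
  simp only [mem_filter, mem_univ, true_and] at hL hmax
  refine ⟨L, hL.1, hL.2, ?_⟩
  intro p hp
  by_contra hcon
  push Not at hcon
  have hcon' : ∀ Y ∈ L, (p.1 ∈ Y ↔ p.2 ∈ Y) := by
    intro Y hY; have := hcon Y hY; tauto
  let cr : Finset V → Finset V → Prop := fun X Z => ¬ X ⊆ Z ∧ ¬ Z ⊆ X ∧ ¬ Disjoint X Z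
  obtain ⟨X, hX, hXmin⟩ := Finset.exists_min_image
    ((univ : Finset (Finset V)).filter (fun X => X.Nonempty ∧ r ∉ X ∧ dE E X = m ∧ ¬ (p.1 ∈ X ↔ p.2 ∈ X)))
    (fun X => (L.filter (fun Z => cr X Z)).card) (by
      obtain ⟨X, hX⟩ := htight p hp
      exact ⟨X, by simpa only [mem_filter, mem_univ, true_and] using hX⟩)
  simp only [mem_filter, mem_univ, true_and] at hX hXmin
  have huniv : ∀ Z : Finset V, r ∉ Z → Z ≠ univ := by
    rintro Z h rfl; simp at h
  obtain ⟨hX1, hX2, hX3, hX4⟩ := hX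
  by_cases hcr : ∃ Y ∈ L, cr X Y
  · obtain ⟨Y, hY, hXY⟩ := hcr
    obtain ⟨hY1, hY2, hY3⟩ := hL.1 Y hY
    have hpY := hcon' Y hY
    have hlt : ∀ X' : Finset V, ¬ cr X' Y → (∀ Z ∈ L, cr X' Z → cr X Z) →
        (L.filter (fun Z => cr X' Z)).card < (L.filter (fun Z => cr X Z)).card := by
      intro X' h1 h2
      apply card_lt_card
      refine (Finset.ssubset_iff_of_subset ?_).2 ⟨Y, by simp only [mem_filter]; exact ⟨hY, hXY⟩, ?_⟩
      · intro Z hZ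
        simp only [mem_filter] at hZ ⊢
        exact ⟨hZ.1, h2 Z hZ.1 hZ.2⟩
      · simp only [mem_filter]; exact fun h => h1 h.2
    obtain ⟨c1, c2, c3⟩ := hXY
    have n1 : (X ∩ Y).Nonempty := by rwa [not_disjoint_iff_nonempty_inter] at c3
    have n2 : (X \ Y).Nonempty := sdiff_nonempty.2 c1
    have n3 : (Y \ X).Nonempty := sdiff_nonempty.2 c2
    have n4 : (X ∪ Y).Nonempty := hX1.mono subset_union_left
    have r1 : r ∉ X ∩ Y := by simp [hX2]
    have r2 : r ∉ X \ Y := by simp [hX2]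
    have r3 : r ∉ Y \ X := by simp [hY2]
    have r4 : r ∉ X ∪ Y := by simp [hX2, hY2]
    have d1 := hcut _ n1 (huniv _ r1)
    have d2 := hcut _ n2 (huniv _ r2)
    have d3 := hcut _ n3 (huniv _ r3)
    have d4 := hcut _ n4 (huniv _ r4)
    have s1 := dE_sub1 E X Y
    have s2 := dE_sub2 E X Y
    by_cases hpin : p.1 ∈ Y
    · have hp2 := hpY.1 hpin
      have := hXmin (X ∩ Y) ⟨n1, r1, by omega, by simpa [hpin, hp2] using hX4⟩
      have h2 := hlt (X ∩ Y) (fun h => h.1 inter_subset_right) (by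
        rintro Z hZ ⟨e1, e2, e3⟩
        rw [not_disjoint_iff] at e3
        obtain ⟨w, hw1, hw2⟩ := e3
        rw [mem_inter] at hw1
        rcases hL.2 Z hZ Y hY with h | h | h
        · refine ⟨fun h' => c1 (h'.trans h), fun h' => e2 (subset_inter h' h), ?_⟩
          rw [not_disjoint_iff]; exact ⟨w, hw1.1, hw2⟩
        · exact absurd (inter_subset_right.trans h) e1
        · exact absurd hw1.2 (disjoint_left.1 h hw2))
      omega
    · have hp2 : p.2 ∉ Y := fun h => hpin (hpY.2 h)
      have := hXmin (X \ Y) ⟨n2, r2, by omega, by simpa [hpin, hp2] using hX4⟩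
      have h2 := hlt (X \ Y) (fun h => h.2.2 sdiff_disjoint) (by
        rintro Z hZ ⟨e1, e2, e3⟩
        rw [not_disjoint_iff] at e3
        obtain ⟨w, hw1, hw2⟩ := e3
        rw [mem_sdiff] at hw1
        have e3' : ¬ Disjoint X Z := by
          rw [not_disjoint_iff]; exact ⟨w, hw1.1, hw2⟩
        rcases hL.2 Z hZ Y hY with h | h | h
        · exact absurd (h hw2) hw1.2
        · exact ⟨fun h' => e1 (sdiff_subset.trans h'), fun h' => c2 (h.trans h'), e3'⟩
        · exact ⟨fun h' => e1 (sdiff_subset.trans h'), fun h' => e2 (subset_sdiff.2 ⟨h', h⟩), e3'⟩)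
      omega
  · push Not at hcr
    have hXL : X ∉ L := fun h => hX4 (hcon' X h)
    have hlam : ∀ Y ∈ L, X ⊆ Y ∨ Y ⊆ X ∨ Disjoint X Y := by
      intro Y hY
      have := hcr Y hY
      simp only [cr] at this
      tauto
    have := hmax (insert X L) ⟨by
      intro Y hY
      rcases mem_insert.1 hY with rfl | h
      · exact ⟨hX1, hX2, hX3⟩
      · exact hL.1 Y h, by
      intro Y hY Z hZ
      rcases mem_insert.1 hY with hYe | hY' <;> rcases mem_insert.1 hZ with hZe | hZ'
      · left; rw [hYe, hZe]
      · rw [hYe]; exact hlam Z hZ'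
      · rw [hZe]; rcases hlam Y hY' with h | h | h
        · right; left; exact h
        · left; exact h
        · right; right; exact h.symm
      · exact hL.2 Y hY' Z hZ'⟩
    rw [card_insert_of_notMem hXL] at this
    omega

end PartL

section PartG
open Finset
set_option linter.unusedSectionVars false
variable {V : Type*} [Fintype V] [DecidableEq V]

theorem exists_sol {ι : Type*} [Fintype ι] (t : ℕ) (a : ι → (Fin t → ZMod 2))
    (ha : LinearIndependent (ZMod 2) a) (c : ι → ZMod 2) (B : Set (Fin t → ZMod 2))
    (hB : B.ncard < 2 ^ (t - Fintype.card ι)) :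
    ∃ y : Fin t → ZMod 2, (∀ i, a i ⬝ᵥ y = c i) ∧ y ∉ B := by
  classical
  let Φ : (Fin t → ZMod 2) →ₗ[ZMod 2] (ι → ZMod 2) := Matrix.mulVecLin (Matrix.of a)
  have hΦ : ∀ y i, Φ y i = a i ⬝ᵥ y := by
    intro y i; simp [Φ, Matrix.mulVec]
  have hrank : Module.finrank (ZMod 2) (LinearMap.range Φ) = Fintype.card ι := by
    have := LinearIndependent.rank_matrix (M := Matrix.of a) ha
    exact this
  have hsurj : Function.Surjective Φ := by
    rw [← LinearMap.range_eq_top]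
    apply Submodule.eq_top_of_finrank_eq
    rw [hrank]; simp
  obtain ⟨y0, hy0⟩ := hsurj c
  have hker : Module.finrank (ZMod 2) (LinearMap.ker Φ) = t - Fintype.card ι := by
    have := LinearMap.finrank_range_add_finrank_ker Φ
    rw [hrank] at this
    simp at this
    omega
  have hcard : Nat.card (LinearMap.ker Φ) = 2 ^ (t - Fintype.card ι) := by
    rw [Module.natCard_eq_pow_finrank (K := ZMod 2), hker]
    simp
  by_contra hcon
  push Not at hcon
  have : Nat.card (LinearMap.ker Φ) ≤ Nat.card B := by
    apply Nat.card_le_card_of_injective (fun z : LinearMap.ker Φ => (⟨y0 + z.1, hcon _ (by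
      intro i
      rw [← hΦ, map_add, LinearMap.mem_ker.1 z.2, hy0]; simp)⟩ : B))
    intro z w h
    simpa using h
  rw [hcard, Nat.card_coe_set_eq] at this
  omega

/-- the bad set -/
def badSet (rank : V → ℕ) (N : V → V → Prop) {t : ℕ} (x : V → (Fin t → ZMod 2)) (v : V) :
    Set (Fin t → ZMod 2) :=
  {y | ∃ w, N v w ∧ rank v < rank w ∧
    y ∈ Submodule.span (ZMod 2) (x '' {u | N u w ∧ rank u < rank w ∧ rank u < rank v})}

theorem labelling (rank : V → ℕ) (hinj : Function.Injective rank) (N : V → V → Prop)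
    (hsym : ∀ u v, N u v → N v u) (ℓ : V → V → ZMod 2)
    (hℓ : ∀ u v, ℓ u v = ℓ v u) (hirr : ∀ v, ¬ N v v) (t : ℕ)
    (hbad : ∀ (x : V → (Fin t → ZMod 2)) (v : V),
      (badSet rank N x v).ncard < 2 ^ (t - {u | N u v ∧ rank u < rank v}.ncard)) :
    ∃ x : V → (Fin t → ZMod 2), ∀ u v, N u v → x u ⬝ᵥ x v = ℓ u v := by
  classical
  have key : ∀ m : ℕ, ∃ x : V → (Fin t → ZMod 2),
      (∀ u v, rank u < m → rank v < m → N u v → x u ⬝ᵥ x v = ℓ u v) ∧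
      ∀ w, LinearIndepOn (ZMod 2) x {u | N u w ∧ rank u < rank w ∧ rank u < m} := by
    intro m
    induction m with
    | zero =>
      refine ⟨fun _ => 0, by simp, ?_⟩
      intro w; simp
    | succ m ih =>
      obtain ⟨x, hx1, hx2⟩ := ih
      by_cases hv : ∃ v, rank v = m
      swap
      · push Not at hv
        have hlt : ∀ u, rank u < m + 1 ↔ rank u < m := by
          intro u; have := hv u; omega
        refine ⟨x, ?_, ?_⟩
        · intro u v h1 h2
          exact hx1 u v ((hlt _).1 h1) ((hlt _).1 h2)
        · simpa only [hlt] using hx2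
      obtain ⟨v, hv⟩ := hv
      have hli := hx2 v
      have hset : {u | N u v ∧ rank u < rank v ∧ rank u < m} = {u | N u v ∧ rank u < rank v} := by
        ext u; simp only [Set.mem_ofPred_eq, hv]; tauto
      rw [hset] at hli
      obtain ⟨y, hy1, hy2⟩ := exists_sol t _ hli (fun u => ℓ u.1 v) (badSet rank N x v) (by
        have := hbad x v
        rwa [← Nat.card_coe_set_eq {u | N u v ∧ rank u < rank v}, Nat.card_eq_fintype_card] at this)
      have hupd : ∀ u, rank u < m → Function.update x v y u = x u := by
        intro u hu
        rw [Function.update_of_ne]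
        rintro rfl; omega
      have hm : ∀ u, rank u < m + 1 → rank u < m ∨ u = v := by
        intro u hu
        by_cases h : rank u < m
        · left; exact h
        · right; apply hinj; omega
      refine ⟨Function.update x v y, ?_, ?_⟩
      · intro u w hu hw huw
        rcases hm u hu with h1 | h1 <;> rcases hm w hw with h2 | h2
        · rw [hupd u h1, hupd w h2]; exact hx1 u w h1 h2 huw
        · subst h2
          rw [hupd u h1, Function.update_self]
          exact hy1 ⟨u, huw, by omega⟩
        · subst h1
          rw [hupd w h2, Function.update_self, dotProduct_comm, hℓ]
          exact hy1 ⟨w, hsym _ _ huw, by omega⟩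
        · subst h1; subst h2; exact absurd huw (hirr _)
      · intro w
        have hcongr : LinearIndepOn (ZMod 2) (Function.update x v y)
            {u | N u w ∧ rank u < rank w ∧ rank u < m} := by
          refine (linearIndepOn_congr ?_).2 (hx2 w)
          intro u hu
          exact hupd u hu.2.2
        by_cases hvw : N v w ∧ rank v < rank w
        · have : {u | N u w ∧ rank u < rank w ∧ rank u < m + 1} =
              insert v {u | N u w ∧ rank u < rank w ∧ rank u < m} := by
            ext u
            simp only [Set.mem_ofPred_eq, Set.mem_insert_iff]
            constructor
            · rintro ⟨h1, h2, h3⟩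
              rcases hm u h3 with h | h
              · right; exact ⟨h1, h2, h⟩
              · left; exact h
            · rintro (rfl | ⟨h1, h2, h3⟩)
              · exact ⟨hvw.1, hvw.2, by omega⟩
              · exact ⟨h1, h2, by omega⟩
          rw [this]
          apply hcongr.insert
          rw [Function.update_self]
          intro hmem
          apply hy2
          refine ⟨w, hvw.1, hvw.2, ?_⟩
          rw [hv]
          have himg : Function.update x v y '' {u | N u w ∧ rank u < rank w ∧ rank u < m} =
              x '' {u | N u w ∧ rank u < rank w ∧ rank u < m} :=
            Set.image_congr (fun u hu => hupd u hu.2.2)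
          rw [himg] at hmem
          exact hmem
        · have : {u | N u w ∧ rank u < rank w ∧ rank u < m + 1} =
              {u | N u w ∧ rank u < rank w ∧ rank u < m} := by
            ext u
            simp only [Set.mem_ofPred_eq]
            constructor
            · rintro ⟨h1, h2, h3⟩
              rcases hm u h3 with h | h
              · exact ⟨h1, h2, h⟩
              · subst h; exact absurd ⟨h1, h2⟩ hvw
            · rintro ⟨h1, h2, h3⟩
              exact ⟨h1, h2, by omega⟩
          rw [this]; exact hcongr
  obtain ⟨x, hx, _⟩ := key ((univ.sup rank) + 1)
  refine ⟨x, fun u v h => hx u v ?_ ?_ h⟩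
  · exact Nat.lt_succ_of_le (Finset.le_sup (mem_univ u))
  · exact Nat.lt_succ_of_le (Finset.le_sup (mem_univ v))
end PartG

section PartR
open Finset
set_option linter.unusedSectionVars false
variable {V : Type*} [Fintype V] [DecidableEq V]

/-- adjacency -/
def adjE (E : Finset (V × V)) (u v : V) : Prop := (u, v) ∈ E ∨ (v, u) ∈ E

theorem exists_rank (K : V → ℕ) : ∃ rank : V → ℕ, Function.Injective rank ∧
    ∀ u v, rank u < rank v → K u ≤ K v := by
  let e := Fintype.equivFin V
  have key : ∀ u v, K u * Fintype.card V + (e u).1 ≤ K v * Fintype.card V + (e v).1 → K u ≤ K v := by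
    intro u v h
    by_contra hc
    push Not at hc
    have h1 := (e v).2
    have : (K v + 1) * Fintype.card V ≤ K u * Fintype.card V := Nat.mul_le_mul_right _ hc
    rw [add_mul] at this
    omega
  refine ⟨fun v => K v * Fintype.card V + (e v).1, ?_, ?_⟩
  · intro u v h
    simp only at h
    have h1 := key u v h.le
    have h2 := key v u h.ge
    have h3 : K u = K v := le_antisymm h1 h2
    rw [h3] at h
    apply e.injective
    apply Fin.ext
    omega
  · intro u v h
    exact key u v h.le

/-- crossing arcs at `u` -/
def cE (E : Finset (V × V)) (X : Finset V) (u : V) : Finset (V × V) :=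
  E.filter (fun e => ¬ (e.1 ∈ X ↔ e.2 ∈ X) ∧ (e.1 = u ∨ e.2 = u))

theorem sum_cE_le (E : Finset (V × V)) (X S : Finset V) (hS : S ⊆ X) :
    ∑ u ∈ S, (cE E X u).card ≤ dE E X := by
  rw [← Finset.card_biUnion]
  · apply card_le_card
    intro e he
    simp only [mem_biUnion, cE, mem_filter] at he ⊢
    obtain ⟨u, _, h1, h2, _⟩ := he
    exact ⟨h1, h2⟩
  · intro u hu v hv huv
    rw [Function.onFun, Finset.disjoint_left]
    intro e h1 h2
    simp only [cE, mem_filter] at h1 h2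
    have hu' := hS hu
    have hv' := hS hv
    obtain ⟨_, h, h3⟩ := h1
    obtain ⟨_, _, h4⟩ := h2
    apply h
    rcases h3 with rfl | rfl <;> rcases h4 with h4 | h4
    · exact absurd h4 huv
    · rw [h4]; simp [hu', hv']
    · rw [h4]; simp [hu', hv']
    · exact absurd h4 huv

open Classical in
theorem nbr_card_le (E : Finset (V × V)) (X : Finset V) (v : V) (hv : v ∈ X) :
    (univ.filter (fun u => adjE E u v ∧ u ∉ X)).card ≤ (cE E X v).card := by
  apply Finset.card_le_card_of_injOn (fun u => if (u, v) ∈ E then (u, v) else (v, u))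
  · intro u hu
    simp only [coe_filter, mem_univ, true_and, Set.mem_ofPred_eq] at hu
    obtain ⟨h1, h2⟩ := hu
    simp only [cE, coe_filter, Set.mem_ofPred_eq]
    by_cases h : (u, v) ∈ E
    · simp [h, h2, hv]
    · have : (v, u) ∈ E := h1.resolve_left h
      simp [h, this, h2, hv]
  · intro u hu w hw h
    simp only [coe_filter, mem_univ, true_and, Set.mem_ofPred_eq] at hu hw
    simp only at h
    have hu2 : u ≠ v := fun h => hu.2 (h ▸ hv)
    have hw2 : w ≠ v := fun h => hw.2 (h ▸ hv)
    split_ifs at h <;> simp only [Prod.mk.injEq] at h <;> tauto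

open Classical in
theorem order_exists (E : Finset (V × V)) (k : ℕ) (L : Finset (Finset V)) (r : V)
    (hL : ∀ X ∈ L, X.Nonempty ∧ r ∉ X ∧ dE E X = 2 * k)
    (hlam : ∀ X ∈ L, ∀ Y ∈ L, X ⊆ Y ∨ Y ⊆ X ∨ Disjoint X Y)
    (hcov : ∀ p ∈ E, ∃ X ∈ L, ¬ (p.1 ∈ X ↔ p.2 ∈ X)) :
    ∃ rank : V → ℕ, Function.Injective rank ∧ ∀ v, ∃ (p : ℕ) (A Dir : Finset V),
      (univ.filter (fun u => adjE E u v ∧ rank u < rank v)).card ≤ p ∧ p ≤ 2 * k ∧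
      A.card + (univ.filter (fun u => adjE E u v ∧ rank u < rank v)).card ≤ 2 * k ∧
      (Dir.card + 1) * p ≤ 2 * k ∧
      ∀ w, adjE E v w → rank v < rank w → w ∈ A ∨
        ∀ u, adjE E u w → rank u < rank v → u ∈ Dir := by
  let Xs : V → Finset V := fun v => univ.filter (fun u => ∀ Y ∈ L, v ∈ Y → u ∈ Y)
  let depth : V → ℕ := fun v => (L.filter (fun Y => v ∈ Y)).card
  let p : V → ℕ := fun v => (cE E (Xs v) v).card
  have hp : ∀ v, p v ≤ E.card := fun v => card_le_card (filter_subset _ _)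
  have hmX : ∀ u v, u ∈ Xs v ↔ ∀ Y ∈ L, v ∈ Y → u ∈ Y := by intro u v; simp [Xs]
  have hself : ∀ v, v ∈ Xs v := by intro v; simp [Xs]
  have F0 : ∀ u v, u ∈ Xs v → L.filter (fun Y => v ∈ Y) ⊆ L.filter (fun Y => u ∈ Y) := by
    intro u v h Y hY
    simp only [mem_filter] at hY ⊢
    exact ⟨hY.1, (hmX u v).1 h Y hY.1 hY.2⟩
  have F1 : ∀ u v, u ∈ Xs v → depth v ≤ depth u := fun u v h => card_le_card (F0 u v h)
  have F1' : ∀ u v, u ∈ Xs v → depth u ≤ depth v → Xs u = Xs v := by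
    intro u v h hd
    have := Finset.eq_of_subset_of_card_le (F0 u v h) hd
    have h2 : ∀ Y ∈ L, (v ∈ Y ↔ u ∈ Y) := by
      intro Y hY
      have := congrArg (fun S => Y ∈ S) this
      simpa [hY] using this
    ext w
    rw [hmX, hmX]
    constructor
    · intro h' Y hY hv; exact h' Y hY ((h2 Y hY).1 hv)
    · intro h' Y hY hv; exact h' Y hY ((h2 Y hY).2 hv)
  have F2 : ∀ v, dE E (Xs v) ≤ 2 * k := by
    intro v
    by_cases hne : (L.filter (fun Y => v ∈ Y)).Nonempty
    · obtain ⟨Y, hY, hmin⟩ := Finset.exists_min_image _ card hne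
      simp only [mem_filter] at hY hmin
      have : Xs v = Y := by
        ext u
        rw [hmX]
        constructor
        · intro h; exact h Y hY.1 hY.2
        · intro hu Z hZ hvZ
          rcases hlam Y hY.1 Z hZ with h | h | h
          · exact h hu
          · rw [Finset.eq_of_subset_of_card_le h (hmin Z ⟨hZ, hvZ⟩)]; exact hu
          · exact absurd hvZ (disjoint_left.1 h hY.2)
      rw [this, (hL Y hY.1).2.2]
    · have : Xs v = univ := by
        ext u
        rw [hmX]
        simp only [mem_univ, iff_true]
        intro Y hY hv
        exact absurd ⟨Y, by simp [hY, hv]⟩ hne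
      rw [this]; simp [dE]
  have F3 : ∀ u v, adjE E u v → u ∈ Xs v → depth v < depth u := by
    intro u v h hu
    have : ∃ Y ∈ L, ¬ (u ∈ Y ↔ v ∈ Y) := by
      rcases h with h | h
      · exact hcov _ h
      · obtain ⟨Y, hY, h'⟩ := hcov _ h
        exact ⟨Y, hY, fun h'' => h' h''.symm⟩
    obtain ⟨Y, hY, hsep⟩ := this
    apply card_lt_card
    refine (Finset.ssubset_iff_of_subset (F0 u v hu)).2 ⟨Y, ?_⟩
    simp only [mem_filter, not_and]
    have h1 := (hmX u v).1 hu Y hY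
    have : u ∈ Y := by by_contra hc; exact hsep ⟨fun h => absurd h hc, h1⟩
    exact ⟨⟨hY, this⟩, fun _ h' => hsep ⟨fun _ => h', fun _ => this⟩⟩
  let K : V → ℕ := fun v => depth v * (E.card + 1) + (E.card - p v)
  have K1 : ∀ u v, K u ≤ K v → depth u ≤ depth v := by
    intro u v h
    by_contra hc
    push Not at hc
    have : (depth v + 1) * (E.card + 1) ≤ depth u * (E.card + 1) := Nat.mul_le_mul_right _ hc
    rw [add_mul (depth v)] at this
    simp only [K] at h
    omega
  have K2 : ∀ u v, K u ≤ K v → depth u = depth v → p v ≤ p u := by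
    intro u v h hd
    simp only [K] at h
    rw [hd] at h
    have h1 := hp u
    have h2 := hp v
    omega
  obtain ⟨rank, hinj, hrank⟩ := exists_rank K
  refine ⟨rank, hinj, fun v => ?_⟩
  have hback : univ.filter (fun u => adjE E u v ∧ rank u < rank v) ⊆
      univ.filter (fun u => adjE E u v ∧ u ∉ Xs v) := by
    intro u hu
    simp only [mem_filter, mem_univ, true_and] at hu ⊢
    refine ⟨hu.1, fun hX => ?_⟩
    have h1 := F3 u v hu.1 hX
    have h2 := K1 _ _ (hrank _ _ hu.2)
    omega
  have hnb := nbr_card_le E (Xs v) v (hself v)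
  let A := univ.filter (fun w => adjE E w v ∧ w ∉ Xs v ∧ rank v < rank w)
  let B := univ.filter (fun w => w ∈ Xs v ∧ w ≠ v ∧ ∃ u, u ∉ Xs v ∧ adjE E u w)
  let Dir := univ.filter (fun u => Xs u = Xs v ∧ rank u < rank v)
  have hA : A.card + (univ.filter (fun u => adjE E u v ∧ rank u < rank v)).card ≤ p v := by
    refine le_trans ?_ hnb
    rw [← card_union_of_disjoint]
    · apply card_le_card
      apply union_subset _ hback
      intro w hw
      simp only [A, mem_filter, mem_univ, true_and] at hw ⊢
      exact ⟨hw.1, hw.2.1⟩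
    · rw [disjoint_left]
      intro w hw hw'
      simp only [A, mem_filter, mem_univ, true_and] at hw hw'
      omega
  have hB : p v + B.card ≤ 2 * k := by
    have hvB : v ∉ B := by simp [B]
    have h1 := sum_cE_le E (Xs v) (insert v B) (by
      intro w hw
      rcases mem_insert.1 hw with rfl | h
      · exact hself _
      · simp only [B, mem_filter, mem_univ, true_and] at h; exact h.1)
    rw [sum_insert hvB] at h1
    have h2 : B.card ≤ ∑ w ∈ B, (cE E (Xs v) w).card := by
      rw [card_eq_sum_ones]
      apply sum_le_sum
      intro w hw
      simp only [B, mem_filter, mem_univ, true_and] at hw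
      obtain ⟨hw1, hw2, u, hu1, hu2⟩ := hw
      apply Nat.succ_le_of_lt
      apply card_pos.2
      rcases hu2 with h | h
      · exact ⟨(u, w), by simp [cE, h, hu1, hw1]⟩
      · exact ⟨(w, u), by simp [cE, h, hu1, hw1]⟩
    have h3 := F2 v
    simp only [p]
    omega
  refine ⟨p v, A ∪ B, Dir, by omega, by omega, ?_, ?_, ?_⟩
  · have := card_union_le A B
    omega
  · have hvD : v ∉ Dir := by simp [Dir]
    have h1 := sum_cE_le E (Xs v) (insert v Dir) (by
      intro w hw
      rcases mem_insert.1 hw with rfl | h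
      · exact hself _
      · simp only [Dir, mem_filter, mem_univ, true_and] at h; rw [← h.1]; exact hself w)
    have h2 : ∑ w ∈ insert v Dir, p v ≤ ∑ w ∈ insert v Dir, (cE E (Xs v) w).card := by
      apply sum_le_sum
      intro w hw
      rcases mem_insert.1 hw with rfl | h
      · exact le_rfl
      · simp only [Dir, mem_filter, mem_univ, true_and] at h
        have h3 : depth w = depth v := le_antisymm
          (F1 v w (by rw [h.1]; exact hself v)) (F1 w v (by rw [← h.1]; exact hself w))
        have := K2 w v (hrank _ _ h.2) h3
        rw [← h.1]; exact this
    rw [sum_const, card_insert_of_notMem hvD, smul_eq_mul] at h2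
    exact h2.trans (h1.trans (F2 v))
  · intro w hvw hlt
    have hwv : w ≠ v := by rintro rfl; omega
    by_cases hw : w ∈ Xs v
    · by_cases hout : ∃ u, u ∉ Xs v ∧ adjE E u w
      · left; apply mem_union_right
        simp only [B, mem_filter, mem_univ, true_and]
        exact ⟨hw, hwv, hout⟩
      · right
        push Not at hout
        intro u hu hur
        have hu1 : u ∈ Xs v := by by_contra hc; exact hout u hc hu
        simp only [Dir, mem_filter, mem_univ, true_and]
        exact ⟨F1' u v hu1 (K1 _ _ (hrank _ _ hur)), hur⟩
    · left; apply mem_union_left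
      simp only [A, mem_filter, mem_univ, true_and]
      exact ⟨hvw.symm, hw, hlt⟩
end PartR

section PartS
open Finset
set_option linter.unusedSectionVars false
variable {V : Type*} [Fintype V] [DecidableEq V]

theorem span_card {t : ℕ} (x : V → (Fin t → ZMod 2)) (J : Finset V) :
    (Submodule.span (ZMod 2) (x '' (J : Set V)) : Set (Fin t → ZMod 2)).ncard ≤ 2 ^ J.card := by
  classical
  rw [← Nat.card_coe_set_eq]
  change Nat.card (Submodule.span (ZMod 2) (x '' (J : Set V))) ≤ _
  rw [Module.natCard_eq_pow_finrank (K := ZMod 2), Nat.card_zmod]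
  apply Nat.pow_le_pow_right (by norm_num)
  rw [← Finset.coe_image]
  exact (finrank_span_finset_le_card _).trans card_image_le

theorem union_bound {W : Type*} [Finite W] [Zero W] (B S0 : Set W) (A : Finset V) (S : V → Set W)
    (M : ℕ) (h0 : (0 : W) ∈ S0) (hS0 : ∀ w ∈ A, (0 : W) ∈ S w) (hS : ∀ w ∈ A, (S w).ncard ≤ M)
    (hB : B ⊆ S0 ∪ ⋃ w ∈ A, S w) : B.ncard ≤ S0.ncard + A.card * (M - 1) := by
  classical
  have := Fintype.ofFinite W
  have h1 : B ⊆ S0 ∪ ↑(A.biUnion (fun w => (S w \ {0}).toFinset)) := by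
    intro y hy
    by_cases hy0 : y = 0
    · left; rw [hy0]; exact h0
    · rcases hB hy with h | h
      · left; exact h
      · right
        simp only [Set.mem_iUnion] at h
        obtain ⟨w, hw, hyw⟩ := h
        simp only [coe_biUnion, Set.mem_iUnion]
        exact ⟨w, hw, by simp [hyw, hy0]⟩
  refine (Set.ncard_le_ncard h1 (Set.toFinite _)).trans ((Set.ncard_union_le _ _).trans ?_)
  rw [Set.ncard_coe_finset]
  apply Nat.add_le_add_left
  apply card_biUnion_le_card_mul
  intro w hw
  rw [← Set.ncard_eq_toFinset_card', Set.ncard_sdiff_singleton_of_mem (hS0 w hw)]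
  exact Nat.sub_le_sub_right (hS w hw) 1

open Classical in
theorem bad_lt (N : V → V → Prop) (hsym : ∀ u v, N u v → N v u) (rank : V → ℕ) (k : ℕ) (hk : 0 < k)
    (hV : 4 ≤ Fintype.card V)
    (hr : ∀ v, ∃ (p : ℕ) (A Dir : Finset V),
      (univ.filter (fun u => N u v ∧ rank u < rank v)).card ≤ p ∧ p ≤ 2 * k ∧
      A.card + (univ.filter (fun u => N u v ∧ rank u < rank v)).card ≤ 2 * k ∧
      (Dir.card + 1) * p ≤ 2 * k ∧
      ∀ w, N v w → rank v < rank w → w ∈ A ∨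
        ∀ u, N u w → rank u < rank v → u ∈ Dir)
    (n t : ℕ) (hn : Fintype.card V = n) (ht : t = Nat.log 2 n + (4 * k - 3))
    (x : V → (Fin t → ZMod 2)) (v : V) :
    (badSet rank N x v).ncard < 2 ^ (t -
      {u | N u v ∧ rank u < rank v}.ncard) := by
  rw [hn] at hV
  obtain ⟨p, A, Dir, h1, h2, h3, h4, h5⟩ := hr v
  set r := (univ.filter (fun u => N u v ∧ rank u < rank v)).card with hrdef
  have hrr : {u | N u v ∧ rank u < rank v}.ncard = r := by
    rw [hrdef, ← Set.ncard_coe_finset]; congr 1; ext u; simp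
  rw [hrr]
  let J : V → Finset V := fun w => univ.filter (fun u => N u w ∧ rank u < rank w ∧ rank u < rank v)
  have hJco : ∀ w, {u | N u w ∧ rank u < rank w ∧ rank u < rank v} = (J w : Set V) := by
    intro w; ext u; simp [J]
  have hJ : ∀ w, N v w → rank v < rank w → (J w).card ≤ 2 * k - 1 := by
    intro w hw hlt
    obtain ⟨p', _, _, g1, g2, _⟩ := hr w
    have : (J w).card < (univ.filter (fun u => N u w ∧ rank u < rank w)).card := by
      apply card_lt_card
      refine (Finset.ssubset_iff_of_subset ?_).2 ⟨v, by simp [hw, hlt], by simp [J]⟩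
      intro u hu
      simp only [J, mem_filter, mem_univ, true_and] at hu ⊢
      exact ⟨hu.1, hu.2.1⟩
    omega
  set M := 2 ^ (2 * k - 1) with hM
  have hM2 : 2 ≤ M := by
    rw [hM]
    calc 2 = 2 ^ 1 := by norm_num
      _ ≤ _ := Nat.pow_le_pow_right (by norm_num) (by omega)
  let Sp : V → Set (Fin t → ZMod 2) := fun w =>
    if N v w ∧ rank v < rank w then (Submodule.span (ZMod 2) (x '' (J w : Set V)) : Set (Fin t → ZMod 2))
    else {0}
  have hSp0 : ∀ w, (0 : Fin t → ZMod 2) ∈ Sp w := by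
    intro w; simp only [Sp]; split_ifs
    · exact Submodule.zero_mem _
    · simp
  have hSpM : ∀ w, (Sp w).ncard ≤ M := by
    intro w
    simp only [Sp]
    split_ifs with h
    · exact (span_card x (J w)).trans (Nat.pow_le_pow_right (by norm_num) (hJ w h.1 h.2))
    · simp; omega
  have hL2 : 2 ≤ Nat.log 2 n := by
    apply (Nat.le_log_iff_pow_le (by norm_num) (by omega)).2
    omega
  rcases Nat.eq_zero_or_pos p with hp | hp
  · have hr0 : r = 0 := by omega
    have hb := union_bound (badSet rank N x v) {0} (univ.erase v) Sp M (by simp) (fun w _ => hSp0 w)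
      (fun w _ => hSpM w) (by
        rintro y ⟨w, hw1, hw2, hy⟩
        right
        simp only [Set.mem_iUnion]
        refine ⟨w, mem_erase.2 ⟨by rintro rfl; omega, mem_univ _⟩, ?_⟩
        simp only [Sp]
        rw [if_pos ⟨hw1, hw2⟩, ← hJco]
        exact hy)
    rw [card_erase_of_mem (mem_univ _), card_univ, Set.ncard_singleton, hn] at hb
    change _ ≤ 1 + (n - 1) * (M - 1) at hb
    rw [hr0, Nat.sub_zero]
    have hlog : n < 2 ^ (Nat.log 2 n + 1) := Nat.lt_pow_succ_log_self (by norm_num) n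
    have hts : t = (Nat.log 2 n + 1) + (4 * k - 4) := by omega
    have hpt : 2 ^ t = 2 ^ (Nat.log 2 n + 1) * 2 ^ (4 * k - 4) := by rw [hts, pow_add]
    rw [hpt]
    refine lt_of_le_of_lt (hb.trans (?_ : _ ≤ n * 2 ^ (4 * k - 4)))
      (Nat.mul_lt_mul_of_pos_right hlog (by positivity))
    obtain ⟨n', hn'⟩ : ∃ n', n = n' + 1 := ⟨n - 1, by omega⟩
    obtain ⟨M', hM'⟩ : ∃ M', M = M' + 1 := ⟨M - 1, by omega⟩
    rcases (by omega : k = 1 ∨ 2 ≤ k) with hk1 | hk1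
    · have : M = 2 := by rw [hM, hk1]; norm_num
      rw [this, hk1]; simp; omega
    · have : M ≤ 2 ^ (4 * k - 4) := Nat.pow_le_pow_right (by norm_num) (by omega)
      refine le_trans ?_ (Nat.mul_le_mul_left n this)
      rw [hn', hM']
      simp only [Nat.add_sub_cancel]
      nlinarith
  · have hb := union_bound (badSet rank N x v)
      (Submodule.span (ZMod 2) (x '' (Dir : Set V)) : Set (Fin t → ZMod 2)) A Sp M
      (Submodule.zero_mem _) (fun w _ => hSp0 w)
      (fun w _ => hSpM w) (by
        rintro y ⟨w, hw1, hw2, hy⟩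
        rcases h5 w hw1 hw2 with h | h
        · right
          simp only [Set.mem_iUnion]
          refine ⟨w, h, ?_⟩
          simp only [Sp]
          rw [if_pos ⟨hw1, hw2⟩, ← hJco]
          exact hy
        · left
          refine Submodule.span_mono ?_ hy
          apply Set.image_mono
          intro u hu
          exact h u hu.1 hu.2.2)
    have hDs := span_card x Dir
    set a := Dir.card
    have ha : a ≤ 2 * k - 1 := by nlinarith [Nat.sub_add_cancel (by omega : 1 ≤ 2 * k)]
    have h2a : 2 ^ a ≤ M := Nat.pow_le_pow_right (by norm_num) ha
    obtain ⟨q, hq⟩ : ∃ q, q = 2 * k - r := ⟨_, rfl⟩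
    have hpow : M * 2 ^ q ≤ 2 ^ (t - r) := by
      rw [hM, ← pow_add]
      exact Nat.pow_le_pow_right (by norm_num) (by omega)
    refine lt_of_lt_of_le (lt_of_le_of_lt (hb.trans (Nat.add_le_add_right hDs _)) ?_) hpow
    have hAq : A.card ≤ q := by omega
    rcases Nat.eq_zero_or_pos q with hq0 | hq0
    · have hA0 : A.card = 0 := by omega
      have hp2 : p = 2 * k := by omega
      have ha0 : a = 0 := by
        rw [hp2] at h4
        by_contra hc
        have : 2 * (2 * k) ≤ (a + 1) * (2 * k) := Nat.mul_le_mul_right _ (by omega)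
        omega
      rw [hA0, ha0, hq0]; simp; omega
    · have h6 : q + 1 ≤ 2 ^ q := Nat.lt_two_pow_self
      have h7 : A.card * (M - 1) ≤ q * (M - 1) := Nat.mul_le_mul_right _ hAq
      obtain ⟨M', hM'⟩ : ∃ M', M = M' + 1 := ⟨M - 1, by omega⟩
      rw [hM'] at h7 h2a ⊢
      simp only [Nat.add_sub_cancel] at h7 ⊢
      have h8 : (M' + 1) * (q + 1) ≤ (M' + 1) * 2 ^ q := Nat.mul_le_mul_left _ h6
      nlinarith
end PartS

section PartT
open Finset
set_option linter.unusedSectionVars false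

theorem dinv_pos {V : Type*} (D : V → V → Prop) (X : Set V) (u v : V) (h : u ∈ X ∧ v ∈ X) :
    dinv D X u v ↔ D v u := by
  simp [dinv, h]

theorem dinv_neg {V : Type*} (D : V → V → Prop) (X : Set V) (u v : V) (h : ¬ (u ∈ X ∧ v ∈ X)) :
    dinv D X u v ↔ D u v := by
  unfold dinv; tauto

open Classical in
/-- parity of the number of inversions hitting the pair -/
noncomputable def par {V : Type*} (Xs : List (Set V)) (u v : V) : ZMod 2 :=
  (Xs.map (fun X => if u ∈ X ∧ v ∈ X then (1 : ZMod 2) else 0)).sum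

theorem par_symm {V : Type*} (Xs : List (Set V)) (u v : V) : par Xs u v = par Xs v u := by
  unfold par
  congr 1
  apply List.map_congr_left
  intro X _
  by_cases h1 : u ∈ X <;> by_cases h2 : v ∈ X <;> simp [h1, h2]

theorem dinvFam_par {V : Type*} (Xs : List (Set V)) : ∀ (D : V → V → Prop) (u v : V),
    (par Xs u v = 0 → (dinvFam D Xs u v ↔ D u v)) ∧ (par Xs u v = 1 → (dinvFam D Xs u v ↔ D v u)) := by
  classical
  induction Xs with
  | nil => intro D u v; simp [par, dinvFam]
  | cons X Xs ih =>
    intro D u v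
    have hfold : dinvFam D (X :: Xs) u v ↔ dinvFam (dinv D X) Xs u v := Iff.rfl
    have hpar : par (X :: Xs) u v = (if u ∈ X ∧ v ∈ X then (1 : ZMod 2) else 0) + par Xs u v := by
      simp [par]
    rw [hfold, hpar]
    have h01 : par Xs u v = 0 ∨ par Xs u v = 1 := by
      generalize par Xs u v = c
      revert c; decide
    have h11 : (1 : ZMod 2) + 1 = 0 := by decide
    obtain ⟨i0, i1⟩ := ih (dinv D X) u v
    by_cases hX : u ∈ X ∧ v ∈ X
    · have hX' : v ∈ X ∧ u ∈ X := hX.symm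
      rw [if_pos hX]
      rcases h01 with h | h
      · rw [i0 h, h]
        refine ⟨fun h => absurd h (by decide), fun _ => ?_⟩
        exact dinv_pos D X u v hX
      · rw [i1 h, h]
        refine ⟨fun _ => ?_, fun h => absurd h (by decide)⟩
        exact dinv_pos D X v u hX'
    · have hX' : ¬ (v ∈ X ∧ u ∈ X) := fun h => hX h.symm
      rw [if_neg hX, zero_add]
      rcases h01 with h | h
      · rw [i0 h, h]
        refine ⟨fun _ => ?_, fun h => absurd h (by decide)⟩
        exact dinv_neg D X u v hX
      · rw [i1 h, h]
        refine ⟨fun h => absurd h (by decide), fun _ => ?_⟩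
        exact dinv_neg D X v u hX'

theorem par_ofFn {V : Type*} {t : ℕ} (x : V → (Fin t → ZMod 2)) (u v : V) :
    par (List.ofFn (fun i : Fin t => {w : V | x w i = 1})) u v = x u ⬝ᵥ x v := by
  classical
  unfold par
  rw [List.map_ofFn, List.sum_ofFn]
  unfold dotProduct
  apply Finset.sum_congr rfl
  intro i _
  simp only [Function.comp, Set.mem_ofPred_eq]
  have key : ∀ a b : ZMod 2, (if a = 1 ∧ b = 1 then (1 : ZMod 2) else 0) = a * b := by decide
  rw [← key]
  split_ifs <;> rfl

variable {V : Type*} [Fintype V] [DecidableEq V]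

theorem final_strong (D : V → V → Prop) (E R : Finset (V × V)) (k : ℕ)
    (hE : ∀ p ∈ E, D p.1 p.2) (hRE : R ⊆ E) (hR : ∀ p ∈ R, p.swap ∉ E)
    (hcut : ∀ X : Finset V, X.Nonempty → X ≠ univ →
        k ≤ (E.filter (fun p => if p ∈ R then p.2 ∈ X ∧ p.1 ∉ X else p.1 ∈ X ∧ p.2 ∉ X)).card)
    (Xs : List (Set V))
    (hXs : ∀ p ∈ E, par Xs p.1 p.2 = if (p.1, p.2) ∈ R ∨ (p.2, p.1) ∈ R then 1 else 0) :
    kArcStrong (dinvFam D Xs) k := by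
  classical
  intro S hS1 hS2
  have h := hcut S.toFinset (by simpa using hS1) (by simpa using hS2)
  refine h.trans ?_
  unfold outCut
  rw [← Set.ncard_coe_finset]
  apply Set.ncard_le_ncard_of_injOn (fun p => if p ∈ R then p.swap else p)
  · intro p hp
    simp only [coe_filter, Set.mem_ofPred_eq, Set.mem_toFinset] at hp
    obtain ⟨hpE, hp⟩ := hp
    have hx := hXs p hpE
    by_cases hpR : p ∈ R
    · simp only [hpR, if_true] at hp ⊢
      rw [if_pos (Or.inl hpR), par_symm] at hx
      exact ⟨hp.1, hp.2, ((dinvFam_par Xs D p.2 p.1).2 hx).2 (hE p hpE)⟩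
    · simp only [hpR, if_false] at hp ⊢
      rw [if_neg] at hx
      · exact ⟨hp.1, hp.2, ((dinvFam_par Xs D p.1 p.2).1 hx).2 (hE p hpE)⟩
      · rintro (h' | h')
        · exact hpR h'
        · exact hR _ h' (by simpa using hpE)
  · intro p hp q hq hpq
    simp only [coe_filter, Set.mem_ofPred_eq] at hp hq
    simp only at hpq
    split_ifs at hpq with h1 h2 h2
    · exact Prod.swap_injective hpq
    · exact absurd (hpq ▸ hq.1) (hR p h1)
    · exact absurd (hpq ▸ hp.1) (hR q h2)
    · exact hpq

open Classical in
theorem cut_of_edgeConn (D : V → V → Prop) (m : ℕ) (hD : edgeConn D m) (X : Finset V)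
    (h1 : X.Nonempty) (h2 : X ≠ univ) :
    m ≤ dE (univ.filter (fun p : V × V => D p.1 p.2)) X := by
  have h := hD (X : Set V) (by simpa using h1) (by simpa using h2)
  refine h.trans ?_
  have e1 : outCut D (X : Set V) =
      (univ.filter (fun p : V × V => p.1 ∈ X ∧ p.2 ∉ X ∧ D p.1 p.2)).card := by
    unfold outCut; rw [← Set.ncard_coe_finset]; congr 1; ext p; simp
  have e2 : outCut (fun a b => D b a) (X : Set V) =
      (univ.filter (fun p : V × V => p.2 ∈ X ∧ p.1 ∉ X ∧ D p.1 p.2)).card := by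
    unfold outCut
    rw [← card_image_of_injective _ Prod.swap_injective, ← Set.ncard_coe_finset]
    congr 1
    ext p
    simp only [coe_image, Set.mem_image, Set.mem_ofPred_eq, coe_filter, mem_univ, true_and, mem_coe]
    constructor
    · intro h; exact ⟨p.swap, by simpa using h, by simp⟩
    · rintro ⟨q, hq, rfl⟩; simpa using hq
  rw [e1, e2, ← card_union_of_disjoint]
  · apply card_le_card
    intro p hp
    simp only [mem_union, mem_filter, mem_univ, true_and] at hp ⊢
    rcases hp with ⟨a, b, c⟩ | ⟨a, b, c⟩
    · exact ⟨c, by simp [a, b]⟩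
    · exact ⟨c, by simp [a, b]⟩
  · rw [disjoint_left]
    intro p hp hp'
    simp only [mem_filter, mem_univ, true_and] at hp hp'
    exact hp'.2.1 hp.1

theorem small_label (n : ℕ) (h2 : n ≤ 3) (ℓ : Fin n → Fin n → ZMod 2) (hℓ : ∀ u v, ℓ u v = ℓ v u) :
    ∃ x : Fin n → (Fin 2 → ZMod 2), ∀ u v, u ≠ v → x u ⬝ᵥ x v = ℓ u v := by
  have main : ∀ g : Fin 3 → Fin 3 → ZMod 2, (∀ u v, g u v = g v u) →
      ∃ x : Fin 3 → (Fin 2 → ZMod 2), ∀ u v, u ≠ v → x u ⬝ᵥ x v = g u v := by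
    intro g hg
    refine ⟨![![1, 0], ![g 0 1, 1], ![g 0 2, g 1 2 + g 0 1 * g 0 2]], ?_⟩
    have e1 := hg 1 0
    have e2 := hg 2 0
    have e3 := hg 2 1
    have k1 : ∀ a b c : ZMod 2, a * b + (c + a * b) = c := by decide
    have k2 : ∀ a b c : ZMod 2, b * a + (c + a * b) = c := by decide
    intro u v huv
    fin_cases u <;> fin_cases v <;> simp [dotProduct, Fin.sum_univ_two, e1, e2, e3, k1, k2] at huv ⊢
  let f : Fin n → Fin 3 := Fin.castLE h2
  obtain ⟨x, hx⟩ := main (fun a b => if h : a.1 < n ∧ b.1 < n then ℓ ⟨a.1, h.1⟩ ⟨b.1, h.2⟩ else 0) (by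
    intro a b
    by_cases h : a.1 < n ∧ b.1 < n
    · rw [dif_pos h, dif_pos h.symm, hℓ]
    · rw [dif_neg h, dif_neg (fun h' => h h'.symm)])
  refine ⟨fun v => x (f v), fun u v huv => ?_⟩
  rw [hx (f u) (f v) (fun h => huv (Fin.castLE_injective h2 h))]
  simp [f]

end PartT

/-- Every `2k`-edge-connected digraph on `n ≥ k+1` vertices can be made `k`-arc-strong by at
most `log₂ n + 4k - 3` inversions. -/
theorem stmt_8 (n k : ℕ) (hk : 0 < k) (hn : k + 1 ≤ n)
    (D : Fin n → Fin n → Prop) (hloop : ∀ v, ¬ D v v) (hD : edgeConn D (2 * k)) :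
    ∃ Xs : List (Set (Fin n)),
      (Xs.length : ℝ) ≤ Real.logb 2 (n : ℝ) + 4 * (k : ℝ) - 3 ∧
      kArcStrong (dinvFam D Xs) k := by
  classical
  have r : Fin n := ⟨0, by omega⟩
  obtain ⟨E, hE0, hcut, htight⟩ := exists_min_E _ (2 * k) (cut_of_edgeConn D (2 * k) hD) r
  obtain ⟨R, hRE, hR, hRcut⟩ := orient E k hcut
  have hED : ∀ p ∈ E, D p.1 p.2 := by
    intro p hp
    have := hE0 hp
    simpa using this
  let ℓ : Fin n → Fin n → ZMod 2 := fun u v => if (u, v) ∈ R ∨ (v, u) ∈ R then 1 else 0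
  have hℓ : ∀ u v, ℓ u v = ℓ v u := by
    intro u v; simp only [ℓ, or_comm]
  have hlog : (Nat.log 2 n : ℝ) ≤ Real.logb 2 n := Real.natLog_le_logb n 2
  have hkR : (1 : ℝ) ≤ k := by exact_mod_cast hk
  have hirr : ∀ v, ¬ adjE E v v := by
    rintro v (h | h) <;> exact hloop v (hED _ h)
  rcases (by omega : n ≤ 3 ∨ 4 ≤ n) with h3 | h4
  · obtain ⟨x, hx⟩ := small_label n h3 ℓ hℓ
    refine ⟨List.ofFn (fun i : Fin 2 => {w | x w i = 1}), ?_, ?_⟩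
    · have h1 : 1 ≤ Nat.log 2 n := by
        apply (Nat.le_log_iff_pow_le (by norm_num) (by omega)).2
        omega
      have h1' : (1 : ℝ) ≤ (Nat.log 2 n : ℝ) := by exact_mod_cast h1
      rw [List.length_ofFn]
      push_cast
      linarith
    · apply final_strong D E R k hED hRE hR hRcut
      intro p hp
      rw [par_ofFn, hx]
      intro h
      apply hirr p.1
      left
      have : p = (p.1, p.1) := Prod.ext rfl h.symm
      rw [← this]; exact hp
  · obtain ⟨L, hL, hlam, hcov⟩ := exists_laminar E (2 * k) r hcut htight
    obtain ⟨rank, hinj, hrank⟩ := order_exists E k L r hL hlam hcov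
    have hsym : ∀ u v, adjE E u v → adjE E v u := fun u v h => h.symm
    obtain ⟨x, hx⟩ := labelling rank hinj (adjE E) hsym ℓ hℓ hirr (Nat.log 2 n + (4 * k - 3))
      (fun x v => bad_lt (adjE E) hsym rank k hk (by simpa using h4) hrank n _ (by simp) rfl x v)
    refine ⟨List.ofFn (fun i => {w | x w i = 1}), ?_, ?_⟩
    · rw [List.length_ofFn]
      push_cast [Nat.cast_sub (by omega : 3 ≤ 4 * k)]
      linarith
    · apply final_strong D E R k hED hRE hR hRcut
      intro p hp
      rw [par_ofFn, hx p.1 p.2 (Or.inl hp)]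
end
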